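/- arXiv:1612.09349 — 6 statements merged into one kernel-verified Lean document; each statement's English description precedes it below -/
import Mathlib

section
/- Suppose that n and w are positive integers such that every finite simple graph with no induced cycle of length at least 5 and clique number at most w - 1 has chromatic number at most n. Then every finite simple graph G with no induced cycle of length at least 5 and clique number at most w has chromatic number at most 4*n^2. -/
open SimpleGraph

/-- The chromatic number of a graph, as a natural number. -/
noncomputable def chi {V : Type*} (G : SimpleGraph V) : ℕ :=
  sInf {n | G.Colorable n}

/-- The independence (stability) number of a graph. -/
noncomputable def indepNum {V : Type*} (G : SimpleGraph V) : ℕ :=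
  sSup {n | ∃ s : Finset V, s.card = n ∧ ∀ a ∈ s, ∀ b ∈ s, ¬ G.Adj a b}

/-- A graph is perfect if every induced subgraph has chromatic number equal to
its clique number. -/
def IsPerfect {V : Type*} (G : SimpleGraph V) : Prop :=
  ∀ s : Set V, chi (G.induce s) = (G.induce s).cliqueNum

/-- A graph is nice if every induced subgraph `H` satisfies `χ(H) - ω(H) ∈ {0, 1}`. -/
def IsNice {V : Type*} (G : SimpleGraph V) : Prop :=
  ∀ s : Set V, chi (G.induce s) = (G.induce s).cliqueNum ∨
    chi (G.induce s) = (G.induce s).cliqueNum + 1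

/-- The perfect chromatic number: the smallest `k` such that the vertex set can be
partitioned into `k` perfect sets. -/
noncomputable def chiP {V : Type*} (G : SimpleGraph V) : ℕ :=
  sInf {k | ∃ f : V → Fin k, ∀ i, IsPerfect (G.induce (f ⁻¹' {i}))}

namespace SimpleGraph

variable {V : Type*} {G : SimpleGraph V}

/-- The graph on the whole vertex type whose edges are the edges of `G` with both ends in `S`. -/
def within (G : SimpleGraph V) (S : Set V) : SimpleGraph V where
  Adj u v := G.Adj u v ∧ u ∈ S ∧ v ∈ S
  symm := ⟨fun _ _ h => ⟨h.1.symm, h.2.2, h.2.1⟩⟩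
  loopless := ⟨fun _ h => G.irrefl h.1⟩

lemma within_mono {S T : Set V} (h : S ⊆ T) : G.within S ≤ G.within T :=
  fun _ _ e => ⟨e.1, h e.2.1, h e.2.2⟩

lemma reachable_within_of_connected {C : Set V} (hC : (G.induce C).Connected) {u v : V}
    (hu : u ∈ C) (hv : v ∈ C) : (G.within C).Reachable u v :=
  (hC.preconnected ⟨u, hu⟩ ⟨v, hv⟩).map
    (⟨Subtype.val, fun {a b} e => ⟨e, a.2, b.2⟩⟩ : G.induce C →g G.within C)

lemma Reachable.exists_geodesic {x y : V} (h : G.Reachable x y) :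
    ∃ (a : ℕ) (f : ℕ → V), f 0 = x ∧ f a = y ∧ (∀ i < a, G.Adj (f i) (f (i + 1))) ∧
      ∀ i ≤ a, G.dist x (f i) = i := by
  obtain ⟨p, hp⟩ := h.exists_walk_length_eq_dist
  refine ⟨p.length, p.getVert, p.getVert_zero, p.getVert_length,
    fun i hi => p.adj_getVert_succ hi, fun i hi => ?_⟩
  have h1 : G.dist x (p.getVert i) ≤ i := (dist_le (p.take i)).trans (by simp)
  obtain ⟨q, hq⟩ := (p.take i).reachable.exists_walk_length_eq_dist
  have h2 := dist_le (q.append (p.drop i))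
  rw [Walk.length_append, Walk.drop_length] at h2
  omega

lemma exists_induced_path {S : Set V} {x y : V} (h : (G.within S).Reachable x y) (hxy : x ≠ y) :
    ∃ (a : ℕ) (f : ℕ → V), f 0 = x ∧ f a = y ∧ (∀ i ≤ a, f i ∈ S) ∧
      (∀ i ≤ a, ∀ j ≤ a, f i = f j → i = j) ∧
      ∀ i ≤ a, ∀ j ≤ a, (G.Adj (f i) (f j) ↔ i + 1 = j ∨ j + 1 = i) := by
  obtain ⟨a, f, h0, ha, hadj, hd⟩ := h.exists_geodesic
  have hapos : 0 < a := by
    rcases Nat.eq_zero_or_pos a with rfl | h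
    · exact absurd (h0.symm.trans ha) hxy
    · exact h
  have hS : ∀ i ≤ a, f i ∈ S := by
    intro i hi
    rcases hi.lt_or_eq with hi | rfl
    · exact (hadj i hi).2.1
    · have := (hadj (i - 1) (by omega)).2.2
      rwa [Nat.sub_add_cancel hapos] at this
  refine ⟨a, f, h0, ha, hS, fun i hi j hj e => ?_, fun i hi j hj => ⟨fun e => ?_, ?_⟩⟩
  · rw [← hd i hi, ← hd j hj, e]
  · have e' : (G.within S).Adj (f i) (f j) := ⟨e, hS i hi, hS j hj⟩
    have hne : i ≠ j := by rintro rfl; exact G.irrefl e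
    have h1 := e'.diff_dist_adj (u := x)
    rw [hd i hi, hd j hj] at h1
    omega
  · rintro (rfl | rfl)
    · exact (hadj i (by omega)).1
    · exact (hadj j (by omega)).1.symm

lemma cycleGraph_adj_of_lt {L : ℕ} {u v : Fin L} (h : u.val < v.val) :
    (cycleGraph L).Adj u v ↔ v.val = u.val + 1 ∨ (u.val = 0 ∧ v.val + 1 = L) := by
  have hv := v.isLt
  rw [cycleGraph_adj', Fin.val_sub, Fin.val_sub, Nat.mod_eq_of_lt (by omega),
    show L - u.val + v.val = (v.val - u.val) + L by omega, Nat.add_mod_right,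
    Nat.mod_eq_of_lt (by omega)]
  omega

lemma nonempty_cycleGraph_embedding {L : ℕ} (F : ℕ → V)
    (hne : ∀ i j, i < j → j < L → F i ≠ F j)
    (hadj : ∀ i j, i < j → j < L → (G.Adj (F i) (F j) ↔ j = i + 1 ∨ (i = 0 ∧ j + 1 = L))) :
    Nonempty (cycleGraph L ↪g G) := by
  refine ⟨⟨⟨fun i => F i.val, fun i j e => ?_⟩, fun {i j} => ?_⟩⟩
  · rcases lt_trichotomy i.val j.val with h | h | h
    · exact absurd e (hne _ _ h j.isLt)
    · exact Fin.ext h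
    · exact absurd e.symm (hne _ _ h i.isLt)
  · change G.Adj (F i.val) (F j.val) ↔ _
    rcases lt_trichotomy i.val j.val with h | h | h
    · rw [hadj _ _ h j.isLt, cycleGraph_adj_of_lt h]
    · obtain rfl := Fin.ext h
      simp
    · rw [G.adj_comm, hadj _ _ h i.isLt, (cycleGraph L).adj_comm, cycleGraph_adj_of_lt h]

/-- Two nonadjacent vertices that are joined through each of two anticomplete sets, with no common
neighbour in the first of these sets, lie on a hole of length at least five. -/
lemma exists_long_hole {P C : Set V} {x y : V} (hne : x ≠ y) (hxy : ¬ G.Adj x y)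
    (hP : (G.within (insert x (insert y P))).Reachable x y)
    (hC : (G.within (insert x (insert y C))).Reachable x y)
    (hPC : ∀ u ∈ P, ∀ v ∈ C, u ≠ v ∧ ¬ G.Adj u v)
    (hcommon : ∀ u ∈ P, G.Adj x u → ¬ G.Adj u y) :
    ∃ ℓ, 5 ≤ ℓ ∧ Nonempty (cycleGraph ℓ ↪g G) := by
  obtain ⟨a, p, p0, pa, pS, pinj, padj⟩ := exists_induced_path hP hne
  obtain ⟨b, q, q0, qb, qS, qinj, qadj⟩ :=
    exists_induced_path (y := x) (hC.symm) hne.symm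
  have interior_p : ∀ i, 0 < i → i < a → p i ∈ P := by
    intro i h0 hi
    rcases pS i hi.le with h | h | h
    · have := pinj i hi.le 0 (by omega) (h.trans p0.symm); omega
    · have := pinj i hi.le a le_rfl (h.trans pa.symm); omega
    · exact h
  have interior_q : ∀ i, 0 < i → i < b → q i ∈ C := by
    intro i h0 hi
    rcases qS i hi.le with h | h | h
    · have := qinj i hi.le b le_rfl (h.trans qb.symm); omega
    · have := qinj i hi.le 0 (by omega) (h.trans q0.symm); omega
    · exact h
  have ha0 : a ≠ 0 := by rintro rfl; exact hne (p0.symm.trans pa)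
  have hb0 : b ≠ 0 := by rintro rfl; exact hne.symm (q0.symm.trans qb)
  have ha1 : a ≠ 1 := by
    rintro rfl
    exact hxy (by rw [← p0, ← pa]; exact (padj 0 (by omega) 1 le_rfl).2 (by omega))
  have hb1 : b ≠ 1 := by
    rintro rfl
    exact hxy (by rw [← q0, ← qb]; exact (qadj 1 le_rfl 0 (by omega)).2 (by omega))
  have ha2 : a ≠ 2 := by
    rintro rfl
    refine hcommon (p 1) (interior_p 1 (by omega) (by omega)) ?_ ?_
    · rw [← p0]; exact (padj 0 (by omega) 1 (by omega)).2 (by omega)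
    · rw [← pa]; exact (padj 1 (by omega) 2 (by omega)).2 (by omega)
  have key : ∀ i j, i < j → j < a + b →
      (if i < a then p i else q (i - a)) ≠ (if j < a then p j else q (j - a)) ∧
      (G.Adj (if i < a then p i else q (i - a)) (if j < a then p j else q (j - a)) ↔
        j = i + 1 ∨ (i = 0 ∧ j + 1 = a + b)) := by
    intro i j hij hj
    by_cases hja : j < a
    · rw [if_pos (by omega), if_pos hja, padj i (by omega) j (by omega)]
      refine ⟨fun e => ?_, by omega⟩
      have := pinj i (by omega) j (by omega) e; omega
    · rw [if_neg hja]
      by_cases hia : i < a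
      · rw [if_pos hia]
        rcases Nat.eq_zero_or_pos i with rfl | hi
        · rw [p0, ← qb, qadj b le_rfl (j - a) (by omega)]
          refine ⟨fun e => ?_, by omega⟩
          have := qinj b le_rfl (j - a) (by omega) e; omega
        · rcases Nat.eq_zero_or_pos (j - a) with hj0 | hj0
          · rw [hj0, q0, ← pa, padj i (by omega) a le_rfl]
            refine ⟨fun e => ?_, by omega⟩
            have := pinj i (by omega) a le_rfl e; omega
          · have h := hPC _ (interior_p i hi hia) _ (interior_q (j - a) hj0 (by omega))
            refine ⟨h.1, fun e => absurd e h.2, by omega⟩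
      · rw [if_neg hia, qadj (i - a) (by omega) (j - a) (by omega)]
        refine ⟨fun e => ?_, by omega⟩
        have := qinj (i - a) (by omega) (j - a) (by omega) e; omega
  exact ⟨a + b, by omega, nonempty_cycleGraph_embedding
    (fun i => if i < a then p i else q (i - a))
    (fun i j h1 h2 => (key i j h1 h2).1) (fun i j h1 h2 => (key i j h1 h2).2)⟩

lemma Connected.exists_adj_dist_lt (hG : G.Connected) (root : V) {v : V} {k : ℕ}
    (hv : G.dist root v = k + 1) : ∃ u, G.Adj u v ∧ G.dist root u = k := by
  obtain ⟨a, f, h0, ha, hadj, hd⟩ := (hG.preconnected root v).exists_geodesic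
  have hak : a = k + 1 := by rw [← hv, ← ha, hd a le_rfl]
  subst hak
  exact ⟨f k, ha ▸ hadj k (by omega), hd k (by omega)⟩

lemma Connected.reachable_within_root (hG : G.Connected) (root : V) (k : ℕ) :
    ∀ (v : V) (S : Set V), G.dist root v = k → v ∈ S →
      (∀ u, G.dist root u < k → u ∈ S) → (G.within S).Reachable v root := by
  induction k with
  | zero =>
    intro v S hv _ _
    rw [(hG.dist_eq_zero_iff).1 hv]
  | succ k ih =>
    intro v S hv hvS hS
    obtain ⟨u, huv, hu⟩ := hG.exists_adj_dist_lt root hv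
    have huS : u ∈ S := hS u (by omega)
    have e : (G.within S).Adj v u := ⟨huv.symm, hvS, huS⟩
    exact e.reachable.trans (ih u S hu huS fun z hz => hS z (by omega))

lemma Adj.dist_le_succ (root : V) {u v : V} (h : G.Adj u v) :
    G.dist root v ≤ G.dist root u + 1 := by
  have := h.diff_dist_adj (u := root)
  omega

lemma Colorable.exists_coloring_on {S : Set V} {n : ℕ} (hn : 0 < n)
    (h : (G.induce S).Colorable n) :
    ∃ f : V → Fin n, ∀ u ∈ S, ∀ v ∈ S, G.Adj u v → f u ≠ f v := by
  classical
  obtain ⟨c⟩ := h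
  refine ⟨fun v => if hv : v ∈ S then c ⟨v, hv⟩ else ⟨0, hn⟩, fun u hu v hv e => ?_⟩
  simp only [hu, hv, dif_pos]
  exact c.valid (v := ⟨u, hu⟩) (w := ⟨v, hv⟩) e

lemma colorable_induce_of_forall_connected {S : Set V} {n : ℕ}
    (h : ∀ C ⊆ S, (G.induce C).Connected → (G.induce C).Colorable n) :
    (G.induce S).Colorable n := by
  rw [colorable_iff_forall_connectedComponent]
  intro c
  let f : c.toSimpleGraph ↪g G := (Embedding.induce S).comp (Embedding.induce c.supp)
  let e := f.isoInduceRange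
  refine Colorable.of_hom e.toHom (h _ ?_ (e.connected_iff.1 c.connected_toSimpleGraph))
  rintro _ ⟨v, rfl⟩
  exact v.1.2

end SimpleGraph

namespace SimpleGraph

variable {V : Type*} {G : SimpleGraph V}

lemma Connected.exists_long_hole_of_level (hG : G.Connected) (root : V) {k : ℕ} {C : Set V}
    (hC : ∀ c ∈ C, G.dist root c = k + 2) (hconn : (G.induce C).Connected)
    {x y r s c d : V} (hxy : ¬ G.Adj x y)
    (hxc : G.Adj x c) (hc : c ∈ C) (hyd : G.Adj y d) (hd : d ∈ C)
    (hy : G.dist root y = k + 1) (hr : G.dist root r = k) (hs : G.dist root s = k)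
    (hrx : G.Adj r x) (hry : ¬ G.Adj r y) (hsy : G.Adj s y) (hsx : ¬ G.Adj s x) :
    ∃ ℓ, 5 ≤ ℓ ∧ Nonempty (cycleGraph ℓ ↪g G) := by
  have hne : x ≠ y := by rintro rfl; exact hry hrx
  refine exists_long_hole (P := {u | u = r ∨ u = s ∨ G.dist root u < k}) (C := C) hne hxy
    ?_ ?_ ?_ ?_
  · have h1 := hG.reachable_within_root root k r
      (insert x (insert y {u | u = r ∨ u = s ∨ G.dist root u < k})) hr (by simp)
      (fun u hu => by simp [hu])
    have h2 := hG.reachable_within_root root k s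
      (insert x (insert y {u | u = r ∨ u = s ∨ G.dist root u < k})) hs (by simp)
      (fun u hu => by simp [hu])
    have e1 : (G.within (insert x (insert y {u | u = r ∨ u = s ∨ G.dist root u < k}))).Adj x r :=
      ⟨hrx.symm, by simp, by simp⟩
    have e2 : (G.within (insert x (insert y {u | u = r ∨ u = s ∨ G.dist root u < k}))).Adj s y :=
      ⟨hsy, by simp, by simp⟩
    exact e1.reachable.trans (h1.trans (h2.symm.trans e2.reachable))
  · have h1 := (reachable_within_of_connected hconn hc hd).mono
      (within_mono (T := insert x (insert y C)) fun z hz => by simp [hz])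
    have e1 : (G.within (insert x (insert y C))).Adj x c := ⟨hxc, by simp, by simp [hc]⟩
    have e2 : (G.within (insert x (insert y C))).Adj d y := ⟨hyd.symm, by simp [hd], by simp⟩
    exact e1.reachable.trans (h1.trans e2.reachable)
  · intro u hu v hv
    have hvd := hC v hv
    have hud : G.dist root u ≤ k := by rcases hu with rfl | rfl | hu <;> omega
    refine ⟨by rintro rfl; omega, fun e => ?_⟩
    have := e.dist_le_succ root
    omega
  · rintro u (rfl | rfl | hu) e1 e2
    · exact hry e2
    · exact hsx e1.symm
    · have := e2.dist_le_succ root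
      have : G.dist root u < k := hu
      omega

lemma Connected.exists_long_hole_of_adj (hG : G.Connected) (root : V) {k : ℕ}
    {x y u v : V} (hxy : ¬ G.Adj x y) (hx : G.dist root x = k + 1) (hy : G.dist root y = k + 1)
    (hu : G.dist root u = k + 2) (hv : G.dist root v = k + 2) (huv : G.Adj u v)
    (hxu : G.Adj x u) (hxv : ¬ G.Adj x v) (hyv : G.Adj y v) (hyu : ¬ G.Adj y u) :
    ∃ ℓ, 5 ≤ ℓ ∧ Nonempty (cycleGraph ℓ ↪g G) := by
  have hne : x ≠ y := by rintro rfl; exact hyu hxu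
  refine exists_long_hole (P := {u, v}) (C := {z | G.dist root z < k + 1}) hne hxy ?_ ?_ ?_ ?_
  · have e1 : (G.within (insert x (insert y {u, v}))).Adj x u := ⟨hxu, by simp, by simp⟩
    have e2 : (G.within (insert x (insert y {u, v}))).Adj u v := ⟨huv, by simp, by simp⟩
    have e3 : (G.within (insert x (insert y {u, v}))).Adj v y := ⟨hyv.symm, by simp, by simp⟩
    exact e1.reachable.trans (e2.reachable.trans e3.reachable)
  · exact (hG.reachable_within_root root (k + 1) x _ hx (Or.inl rfl)
      (fun z hz => Or.inr (Or.inr hz))).trans (hG.reachable_within_root root (k + 1) y _ hy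
      (Or.inr (Or.inl rfl))
      (fun z hz => Or.inr (Or.inr hz))).symm
  · intro a ha b hb
    have hb' : G.dist root b < k + 1 := hb
    have had : G.dist root a = k + 2 := by rcases ha with rfl | rfl <;> assumption
    refine ⟨by rintro rfl; omega, fun e => ?_⟩
    have := e.symm.dist_le_succ root
    omega
  · rintro a (rfl | rfl) e1 e2
    · exact hyu e2.symm
    · exact hxv e1

/-- The parents of a connected subset of a level are covered by two neighbourhoods. -/
lemma Connected.exists_cover_parents [Finite V] (hG : G.Connected)
    (hole : ∀ ℓ, 5 ≤ ℓ → IsEmpty (cycleGraph ℓ ↪g G)) (root : V) {k : ℕ} {C : Set V}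
    (hC : ∀ c ∈ C, G.dist root c = k + 2) (hconn : (G.induce C).Connected) :
    ∃ r p, ∀ x, G.dist root x = k + 1 → (∃ c ∈ C, G.Adj x c) → G.Adj r x ∨ G.Adj p x := by
  classical
  set X : Set V := {x | G.dist root x = k + 1 ∧ ∃ c ∈ C, G.Adj x c}
  let covers : Set V → Prop := fun T =>
    (∀ t ∈ T, G.dist root t = k) ∧ ∀ x ∈ X, ∃ t ∈ T, G.Adj t x
  have hex : ∃ T, covers T := ⟨{t | G.dist root t = k}, fun t ht => ht, fun x hx => by
    obtain ⟨u, h1, h2⟩ := hG.exists_adj_dist_lt root hx.1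
    exact ⟨u, h2, h1⟩⟩
  obtain ⟨T, hT⟩ := (Set.toFinite {T | covers T}).exists_minimal hex
  by_cases hTe : T = ∅
  · refine ⟨root, root, fun x hx hc => ?_⟩
    obtain ⟨t, ht, -⟩ := hT.1.2 x ⟨hx, hc⟩
    simp [hTe] at ht
  obtain ⟨r, hr⟩ := Set.nonempty_iff_ne_empty.2 hTe
  have hnot : ¬ covers (T \ {r}) := fun h => (hT.2 h Set.sdiff_subset hr).2 rfl
  obtain ⟨p, hp, hpT⟩ : ∃ p ∈ X, ∀ t ∈ T, G.Adj t p → t = r := by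
    by_contra! hcon
    refine hnot ⟨fun t ht => hT.1.1 t ht.1, fun x hx => ?_⟩
    obtain ⟨t, ht, h1, h2⟩ := hcon x hx
    exact ⟨t, ⟨ht, h2⟩, h1⟩
  have hrp : G.Adj r p := by
    obtain ⟨t, ht, h⟩ := hT.1.2 p hp
    exact hpT t ht h ▸ h
  refine ⟨r, p, fun x hx hc => ?_⟩
  by_contra! hcon
  obtain ⟨s, hs, hsx⟩ := hT.1.2 x ⟨hx, hc⟩
  obtain ⟨c, hcC, hxc⟩ := hc
  obtain ⟨d, hdC, hpd⟩ := hp.2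
  obtain ⟨ℓ, hℓ, ⟨e⟩⟩ := hG.exists_long_hole_of_level root hC hconn hcon.2 hpd hdC hxc hcC
    hx (hT.1.1 r hr) (hT.1.1 s hs) hrp hcon.1 hsx
    (fun h => hcon.1 (hpT s hs h ▸ hsx))
  exact (hole ℓ hℓ).false e

lemma Connected.colorable_induce_of_level [Finite V] (hG : G.Connected)
    (hole : ∀ ℓ, 5 ≤ ℓ → IsEmpty (cycleGraph ℓ ↪g G)) {n w : ℕ} (hn : 0 < n)
    (hw : 0 < w) (hω : ∀ Q : Finset V, G.IsClique Q → Q.card ≤ w)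
    (hcol : ∀ S : Set V, (∀ Q : Finset V, (Q : Set V) ⊆ S → G.IsClique Q → Q.card < w) →
      (G.induce S).Colorable n)
    (root : V) {k : ℕ} {C : Set V} (hC : ∀ c ∈ C, G.dist root c = k)
    (hconn : (G.induce C).Connected) : (G.induce C).Colorable (2 * n ^ 2) := by
  classical
  have hnbr : ∀ v, (G.induce {u | G.Adj v u}).Colorable n := by
    refine fun v => hcol _ fun Q hQ hcl => ?_
    have h1 : v ∉ Q := fun h => G.irrefl (hQ h)
    have h2 : G.IsClique (insert v Q : Finset V) := by
      rw [Finset.coe_insert]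
      exact hcl.insert fun b hb _ => hQ hb
    have := hω _ h2
    rw [Finset.card_insert_of_notMem h1] at this
    omega
  have hnn : n ≤ 2 * n ^ 2 := by nlinarith
  match k, hC with
  | 0, hC =>
    refine Colorable.mono (n := 1) (by nlinarith) ⟨Coloring.mk (fun _ => 0) ?_⟩
    intro u v e
    have e1 := (hG.dist_eq_zero_iff).1 (hC u u.2)
    have e2 := (hG.dist_eq_zero_iff).1 (hC v v.2)
    exact absurd (Subtype.ext (e1.symm.trans e2)) e.ne
  | 1, hC =>
    refine ((hnbr root).of_hom (induceHomOfLE G ?_).toHom).mono hnn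
    exact fun c hc => dist_eq_one_iff_adj.1 (hC c hc)
  | k + 2, hC =>
    obtain ⟨r, p, hrp⟩ := hG.exists_cover_parents hole root hC hconn
    obtain ⟨f, hf⟩ := (hnbr r).exists_coloring_on hn
    obtain ⟨g, hg⟩ := (hnbr p).exists_coloring_on hn
    let φ : V → Fin 2 × Fin n := fun v => if G.Adj r v then (0, f v) else (1, g v)
    have hφ : ∀ x y, (G.dist root x = k + 1 ∧ ∃ c ∈ C, G.Adj x c) →
        (G.dist root y = k + 1 ∧ ∃ c ∈ C, G.Adj y c) → φ x = φ y → ¬ G.Adj x y := by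
      intro x y hx hy hxy e
      by_cases h1 : G.Adj r x <;> by_cases h2 : G.Adj r y <;> simp [φ, h1, h2] at hxy
      · exact hf x h1 y h2 e hxy
      · exact hg x ((hrp x hx.1 hx.2).resolve_left h1) y
          ((hrp y hy.1 hy.2).resolve_left h2) e hxy
    have hpar : ∀ c : C, ∃ x, G.Adj x c ∧ G.dist root x = k + 1 := fun c =>
      hG.exists_adj_dist_lt root (hC c c.2)
    choose π hπ hπd using hpar
    have hcls : ∀ i, (G.induce {c | ∃ h : c ∈ C, φ (π ⟨c, h⟩) = i}).Colorable n := by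
      refine fun i => hcol _ fun Q hQ hcl => ?_
      rcases Q.eq_empty_or_nonempty with rfl | hQne
      · simpa using hw
      let S : V → Set V := fun c => {x | G.dist root x = k + 1 ∧ φ x = i ∧ G.Adj x c}
      obtain ⟨q, hq, hmin⟩ := Q.exists_min_image (fun c => (S c).ncard) hQne
      obtain ⟨hqC, hqi⟩ := hQ hq
      have hall : ∀ c ∈ Q, G.Adj (π ⟨q, hqC⟩) c := by
        intro c hc
        by_contra hcon
        obtain ⟨hcC, -⟩ := hQ hc
        have hqc : q ≠ c := by rintro rfl; exact hcon (hπ ⟨q, hqC⟩)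
        obtain ⟨y, hyc, hyq⟩ : ∃ y ∈ S c, y ∉ S q := by
          by_contra! hsub
          have : (S c).ncard < (S q).ncard := Set.ncard_lt_ncard
            ⟨hsub, fun h => hcon (h (show π ⟨q, hqC⟩ ∈ S q from
              ⟨hπd _, hqi, hπ ⟨q, hqC⟩⟩)).2.2⟩ (Set.toFinite _)
          exact absurd (hmin c hc) (by omega)
        have hna := hφ (π ⟨q, hqC⟩) y ⟨hπd _, q, hqC, hπ ⟨q, hqC⟩⟩ ⟨hyc.1, c, hcC, hyc.2.2⟩
          (hqi.trans hyc.2.1.symm)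
        obtain ⟨ℓ, hℓ, ⟨e⟩⟩ := hG.exists_long_hole_of_adj root hna (hπd _) hyc.1 (hC q hqC)
          (hC c hcC) (hcl hq hc hqc) (hπ ⟨q, hqC⟩) hcon hyc.2.2
          (fun h => hyq ⟨hyc.1, hyc.2.1, h⟩)
        exact (hole ℓ hℓ).false e
      have h1 : π ⟨q, hqC⟩ ∉ Q := fun h => G.irrefl (hall _ h)
      have h2 : G.IsClique (insert (π ⟨q, hqC⟩) Q : Finset V) := by
        rw [Finset.coe_insert]
        exact hcl.insert fun b hb _ => hall b hb
      have := hω _ h2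
      rw [Finset.card_insert_of_notMem h1] at this
      omega
    choose ψ hψ using fun i => (hcls i).exists_coloring_on hn
    have col : (G.induce C).Coloring ((Fin 2 × Fin n) × Fin n) :=
      Coloring.mk (fun c => (φ (π c), ψ (φ (π c)) c)) fun {u v} e heq => by
        simp only [Prod.mk.injEq] at heq
        refine hψ (φ (π u)) u ⟨u.2, rfl⟩ v ⟨v.2, heq.1.symm⟩ e ?_
        rw [heq.2, heq.1]
    refine col.colorable.mono ?_
    simp
    nlinarith

lemma colorable_of_levels {m : ℕ} (root : V) (hm : 0 < m)
    (h : ∀ k, (G.induce {v | G.dist root v = k}).Colorable m) : G.Colorable (2 * m) := by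
  choose f hf using fun k => (h k).exists_coloring_on hm
  have col : G.Coloring (Fin 2 × Fin m) :=
    Coloring.mk (fun v => (⟨G.dist root v % 2, Nat.mod_lt _ two_pos⟩, f (G.dist root v) v))
      fun {u v} e heq => by
        simp only [Prod.mk.injEq, Fin.mk.injEq] at heq
        have h1 := e.dist_le_succ root
        have h2 := e.symm.dist_le_succ root
        have h3 : G.dist root u = G.dist root v := by omega
        rw [← h3] at heq
        exact hf (G.dist root u) u rfl v h3.symm e heq.2
  simpa using col.colorable

end SimpleGraph

lemma chi_le_iff {V : Type*} [Fintype V] {G : SimpleGraph V} {n : ℕ} :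
    chi G ≤ n ↔ G.Colorable n :=
  ⟨fun h => Colorable.mono h (Nat.sInf_mem (s := {n | G.Colorable n}) ⟨_, G.colorable_of_fintype⟩),
    fun h => Nat.sInf_le h⟩

lemma no_long_hole_iff {V : Type*} {G : SimpleGraph V} :
    (∀ (ℓ : ℕ) (s : Set V), 5 ≤ ℓ → ¬ Nonempty (G.induce s ≃g cycleGraph ℓ)) ↔
      ∀ ℓ, 5 ≤ ℓ → IsEmpty (cycleGraph ℓ ↪g G) := by
  refine ⟨fun h ℓ hℓ => ⟨fun e => h ℓ _ hℓ ⟨e.isoInduceRange.symm⟩⟩, fun h ℓ s hℓ ⟨e⟩ => ?_⟩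
  exact (h ℓ hℓ).false ((Embedding.induce s).comp e.symm.toEmbedding)

/-- If every graph with no induced cycle of length at least 5 and clique number at most
`w - 1` has chromatic number at most `n`, then every graph with no induced cycle of length
at least 5 and clique number at most `w` has chromatic number at most `4 * n ^ 2`. -/
theorem stmt_0 (n w : ℕ) (hn : 0 < n) (hw : 0 < w)
    (h : ∀ (V : Type) [Fintype V] (G : SimpleGraph V),
      (∀ (ℓ : ℕ) (s : Set V), 5 ≤ ℓ → ¬ Nonempty (G.induce s ≃g cycleGraph ℓ)) →
      G.cliqueNum ≤ w - 1 → chi G ≤ n) :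
    ∀ (V : Type) [Fintype V] (G : SimpleGraph V),
      (∀ (ℓ : ℕ) (s : Set V), 5 ≤ ℓ → ¬ Nonempty (G.induce s ≃g cycleGraph ℓ)) →
      G.cliqueNum ≤ w → chi G ≤ 4 * n ^ 2 := by
  intro V _ G hole hω
  classical
  rw [no_long_hole_iff] at hole
  rw [chi_le_iff, colorable_iff_forall_connectedComponent]
  intro c
  have hole' : ∀ ℓ, 5 ≤ ℓ → IsEmpty (cycleGraph ℓ ↪g c.toSimpleGraph) := fun ℓ hℓ =>
    ⟨fun e => (hole ℓ hℓ).false ((Embedding.induce c.supp).comp e)⟩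
  have hω' : ∀ Q : Finset c, c.toSimpleGraph.IsClique Q → Q.card ≤ w := fun Q hQ =>
    (hQ.card_le_cliqueNum).trans ((G.cliqueNum_induce_le c.supp).trans hω)
  have hcol : ∀ S : Set c, (∀ Q : Finset c, (Q : Set c) ⊆ S → c.toSimpleGraph.IsClique Q →
      Q.card < w) → (c.toSimpleGraph.induce S).Colorable n := by
    intro S hS
    rw [← chi_le_iff]
    refine h S _ (no_long_hole_iff.2 fun ℓ hℓ =>
      ⟨fun e => (hole' ℓ hℓ).false ((Embedding.induce S).comp e)⟩) ?_
    obtain ⟨Q, hQ⟩ := (c.toSimpleGraph.induce S).exists_isNClique_cliqueNum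
    have := hS (Q.map (Function.Embedding.subtype _)) (by simp) (by
      rw [Finset.coe_map]
      exact isClique_induce_iff.1 hQ.isClique)
    rw [Finset.card_map, hQ.card_eq] at this
    omega
  have hconn := c.connected_toSimpleGraph
  obtain ⟨root⟩ := hconn.nonempty
  have := colorable_of_levels (m := 2 * n ^ 2) root (by positivity) fun k =>
    colorable_induce_of_forall_connected fun C hC hCc =>
      hconn.colorable_induce_of_level hole' hn hw hω' hcol root hC hCc
  rwa [← mul_assoc] at this
end

section
/- Let G be a finite simple graph with no induced cycle of length at least 5. Then χ(G) ≤ 2^(2^ω(G)). -/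
open SimpleGraph

namespace SimpleGraph

universe u

variable {V : Type u} {G : SimpleGraph V}

/-- A graph has no long holes if it has no induced cycle of length at least five. -/
def NoLongHole (G : SimpleGraph V) : Prop :=
  ∀ ℓ : ℕ, 5 ≤ ℓ → IsEmpty (cycleGraph ℓ ↪g G)

theorem NoLongHole.induce (hG : G.NoLongHole) (s : Set V) : (G.induce s).NoLongHole :=
  fun ℓ hℓ ↦ ⟨fun f ↦ (hG ℓ hℓ).false (f.trans (Embedding.induce s))⟩

/-- Two distinct nonadjacent vertices with neighbors in a connected set `A` are joined by an
induced path with interior in `A`. -/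
theorem exists_induced_path_s1 {A : Set V} {u v : V} (hA : (G.induce A).Connected)
    (hu : ∃ a ∈ A, G.Adj u a) (hv : ∃ a ∈ A, G.Adj v a) (huv : u ≠ v) (hn : ¬ G.Adj u v) :
    ∃ (n : ℕ) (p : ℕ → V), 2 ≤ n ∧ p 0 = u ∧ p n = v ∧ (∀ i, 0 < i → i < n → p i ∈ A) ∧
      ∀ i j, i < j → j ≤ n → p i ≠ p j ∧ (G.Adj (p i) (p j) ↔ j = i + 1) := by
  obtain ⟨a, ha, hua⟩ := hu
  obtain ⟨b, hb, hvb⟩ := hv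
  let S : Set V := A ∪ {u, v}
  have huS : u ∈ S := by simp [S]
  have hvS : v ∈ S := by simp [S]
  have hAS : A ⊆ S := Set.subset_union_left
  have hreach : (G.induce S).Reachable ⟨u, huS⟩ ⟨v, hvS⟩ := by
    have h1 : (G.induce S).Adj ⟨u, huS⟩ ⟨a, hAS ha⟩ := hua
    have h2 : (G.induce S).Adj ⟨b, hAS hb⟩ ⟨v, hvS⟩ := hvb.symm
    have h3 : (G.induce S).Reachable ⟨a, hAS ha⟩ ⟨b, hAS hb⟩ :=
      (hA.preconnected ⟨a, ha⟩ ⟨b, hb⟩).map (induceHomOfLE _ hAS).toHom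
    exact h1.reachable.trans (h3.trans h2.reachable)
  obtain ⟨w, hw, hlen⟩ := hreach.exists_path_of_dist
  have hinj := hw.getVert_injOn
  have hadj : ∀ i j, i < j → j ≤ w.length → (G.induce S).Adj (w.getVert i) (w.getVert j) →
      j = i + 1 := by
    intro i j hij hj h
    have h1 := dist_le ((w.take i).append (Walk.cons h (w.drop j)))
    simp only [Walk.length_append, Walk.length_cons, Walk.take_length, Walk.drop_length] at h1
    omega
  have hne : ∀ i j, i < j → j ≤ w.length → w.getVert i ≠ w.getVert j := by
    intro i j hij hj h
    have := hinj (show i ≤ w.length by omega) hj h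
    omega
  have h0 : (w.getVert 0 : V) = u := by simp
  have h1 : (w.getVert w.length : V) = v := by simp
  refine ⟨w.length, fun i ↦ w.getVert i, ?_, h0, h1, ?_, ?_⟩
  · by_contra hlt
    have : w.length = 0 ∨ w.length = 1 := by omega
    rcases this with h | h
    · rw [h, h0] at h1
      exact huv h1
    · have h2 : G.Adj (w.getVert 0) (w.getVert 1) := w.adj_getVert_succ (i := 0) (by omega)
      rw [h] at h1
      rw [h0, h1] at h2
      exact hn h2
  · intro i hi hin
    rcases (w.getVert i).2 with h | h | h
    · exact h
    · exact absurd (Subtype.ext (h0.trans h.symm)) (hne 0 i hi hin.le)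
    · exact absurd (Subtype.ext (Eq.trans h h1.symm)) (hne i _ hin le_rfl)
  · intro i j hij hj
    refine ⟨fun h ↦ hne i j hij hj (Subtype.ext h), hadj i j hij hj, ?_⟩
    rintro rfl
    exact w.adj_getVert_succ (by omega)

/-- In a graph without long holes, if two distinct nonadjacent vertices both have neighbors in
each of two anticomplete connected sets, then they have a common neighbor in the first one. -/
theorem NoLongHole.exists_common_adj (hG : G.NoLongHole) {A B : Set V} {u v : V}
    (hA : (G.induce A).Connected) (hB : (G.induce B).Connected)
    (hAB : ∀ a ∈ A, ∀ b ∈ B, a ≠ b ∧ ¬ G.Adj a b)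
    (huA : ∃ a ∈ A, G.Adj u a) (hvA : ∃ a ∈ A, G.Adj v a)
    (huB : ∃ b ∈ B, G.Adj u b) (hvB : ∃ b ∈ B, G.Adj v b)
    (huv : u ≠ v) (hn : ¬ G.Adj u v) : ∃ a ∈ A, G.Adj u a ∧ G.Adj v a := by
  by_contra hno
  obtain ⟨a, p, ha, hp0, hpa, hpA, hp⟩ := exists_induced_path_s1 hA huA hvA huv hn
  obtain ⟨b, q, hb, hq0, hqb, hqB, hq⟩ := exists_induced_path_s1 hB huB hvB huv hn
  have ha3 : 3 ≤ a := by
    by_contra hlt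
    obtain rfl : a = 2 := by omega
    refine hno ⟨p 1, hpA 1 (by omega) (by omega), ?_, ?_⟩
    · rw [← hp0]
      exact (hp 0 1 (by omega) (by omega)).2.2 rfl
    · rw [← hpa]
      exact ((hp 1 2 (by omega) (by omega)).2.2 rfl).symm
  let f : ℕ → V := fun i ↦ if i ≤ a then p i else q (a + b - i)
  have key : ∀ i j, i < j → j < a + b →
      f i ≠ f j ∧ (G.Adj (f i) (f j) ↔ j = i + 1 ∨ (i = 0 ∧ j + 1 = a + b)) := by
    intro i j hij hj
    rcases le_or_gt j a with hja | hja
    · have := hp i j hij hja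
      simp only [f, if_pos hja, if_pos (hij.le.trans hja)]
      refine ⟨this.1, this.2.trans ?_⟩
      omega
    · have hjf : f j = q (a + b - j) := if_neg (by omega)
      rcases lt_trichotomy i a with hia | hia | hia
      · have hif : f i = p i := if_pos hia.le
        rcases Nat.eq_zero_or_pos i with rfl | hi
        · have := hq 0 (a + b - j) (by omega) (by omega)
          rw [hif, hjf, hp0, ← hq0]
          refine ⟨this.1, this.2.trans ?_⟩
          omega
        · have := hAB (p i) (hpA i hi hia) (q (a + b - j)) (hqB _ (by omega) (by omega))
          rw [hif, hjf]
          refine ⟨this.1, iff_of_false this.2 ?_⟩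
          omega
      · have hif : f i = p i := if_pos hia.le
        have := hq (a + b - j) b (by omega) le_rfl
        rw [hif, hjf, hia, hpa, ← hqb, G.adj_comm]
        refine ⟨this.1.symm, this.2.trans ?_⟩
        omega
      · have hif : f i = q (a + b - i) := if_neg (by omega)
        have := hq (a + b - j) (a + b - i) (by omega) (by omega)
        rw [hif, hjf, G.adj_comm]
        refine ⟨this.1.symm, this.2.trans ?_⟩
        omega
  have hcyc : ∀ i j : Fin (a + b), i < j →
      ((cycleGraph (a + b)).Adj i j ↔ j.1 = i.1 + 1 ∨ (i.1 = 0 ∧ j.1 + 1 = a + b)) := by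
    intro i j hij
    have hij' : i.1 < j.1 := hij
    rw [cycleGraph_adj', Fin.sub_val_of_le hij.le, Fin.val_sub]
    rw [Nat.mod_eq_of_lt (by omega)]
    omega
  refine (hG (a + b) (by omega)).false ⟨⟨fun i ↦ f i, ?_⟩, ?_⟩
  · intro i j h
    rcases lt_trichotomy i j with hij | hij | hij
    · exact absurd h (key i j hij j.2).1
    · exact hij
    · exact absurd h.symm (key j i hij i.2).1
  · intro i j
    change G.Adj (f i) (f j) ↔ _
    rcases lt_trichotomy i j with hij | rfl | hij
    · rw [hcyc i j hij, (key i j hij j.2).2]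
    · simp
    · rw [G.adj_comm, (cycleGraph _).adj_comm, hcyc j i hij, (key j i hij i.2).2]

/-- The vertex set of a connected component of an induced subgraph is connected. -/
theorem connected_induce_image_supp {S : Set V} (c : (G.induce S).ConnectedComponent) :
    (G.induce (Subtype.val '' c.supp)).Connected := by
  let f : c.toSimpleGraph →g G.induce (Subtype.val '' c.supp) :=
    ⟨fun x ↦ ⟨x.1.1, x.1, x.2, rfl⟩, fun h ↦ h⟩
  refine c.connected_toSimpleGraph.map f ?_
  rintro ⟨_, x, hx, rfl⟩
  exact ⟨⟨x, hx⟩, rfl⟩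

/-- A set of vertices is colorable if every component of the subgraph it induces is. -/
theorem colorable_induce_of_components {S : Set V} {n : ℕ}
    (h : ∀ c : (G.induce S).ConnectedComponent, (G.induce (Subtype.val '' c.supp)).Colorable n) :
    (G.induce S).Colorable n := by
  refine colorable_iff_forall_connectedComponent.2 fun c ↦ (h c).of_hom ?_
  exact ⟨fun x ↦ ⟨x.1.1, x.1, x.2, rfl⟩, fun h ↦ h⟩

/-- If a set is partitioned into `k` classes each of which is `n`-colorable, then it is
`k * n`-colorable. -/
theorem colorable_induce_of_partition {ι : Type*} [Fintype ι] {C : Set V} {n : ℕ} (f : V → ι)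
    (h : ∀ i, (G.induce {v | v ∈ C ∧ f v = i}).Colorable n) :
    (G.induce C).Colorable (Fintype.card ι * n) := by
  let col := fun i ↦ (h i).some
  let g : (G.induce C).Coloring (ι × Fin n) := Coloring.mk
    (fun v ↦ (f v.1, col (f v.1) ⟨v.1, v.2, rfl⟩)) (by
      rintro ⟨v, hv⟩ ⟨w, hw⟩ hvw heq
      simp only [Prod.mk.injEq] at heq
      obtain ⟨h1, h2⟩ := heq
      have h3 : ∀ i (hi : f w = i), col i ⟨w, hw, hi⟩ = col (f w) ⟨w, hw, rfl⟩ := by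
        rintro i rfl
        rfl
      rw [← h3 _ h1.symm] at h2
      exact (col (f v)).valid (v := ⟨v, hv, rfl⟩) (w := ⟨w, hw, h1.symm⟩) hvw h2)
  simpa using g.colorable

/-- Let `Z` be anticomplete to a connected set `B`, and let every `z ∈ Z` have a neighbor `p z`
which itself has a neighbor in `B`. If adjacent members of `Z` have nonadjacent such neighbors,
then `Z` has smaller clique number than `G`. -/
theorem NoLongHole.cliqueFreeOn_of_cover (hG : G.NoLongHole) {w : ℕ} (hw : 1 ≤ w)
    (hfree : G.CliqueFree (w + 1)) {B Z : Set V} (hB : (G.induce B).Connected)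
    (hZB : ∀ z ∈ Z, ∀ b ∈ B, z ≠ b ∧ ¬ G.Adj z b) (p : V → V)
    (hp : ∀ z ∈ Z, G.Adj (p z) z) (hpB : ∀ z ∈ Z, ∃ b ∈ B, G.Adj (p z) b)
    (hst : ∀ z ∈ Z, ∀ z' ∈ Z, G.Adj z z' → ¬ G.Adj (p z) (p z')) : G.CliqueFreeOn Z w := by
  classical
  intro t htZ ht
  have htne : t.Nonempty := by
    rw [← Finset.card_pos, ht.card_eq]
    omega
  let N : V → Finset V := fun z ↦ (t.image p).filter fun x ↦ G.Adj x z
  obtain ⟨z, hz, hmin⟩ := t.exists_min_image (fun z ↦ (N z).card) htne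
  have hsub : ∀ z' ∈ t, N z ⊆ N z' := by
    intro z' hz'
    by_contra hnot
    obtain ⟨x, hx, hx'⟩ := Finset.not_subset.1 hnot
    have hnot' : ¬ N z' ⊆ N z := fun h ↦
      (Finset.card_lt_card (Finset.ssubset_iff_subset_ne.2
        ⟨h, fun heq ↦ hx' (heq ▸ hx)⟩)).not_ge (hmin z' hz')
    obtain ⟨y, hy, hy'⟩ := Finset.not_subset.1 hnot'
    simp only [N, Finset.mem_filter, Finset.mem_image, not_and] at hx hx' hy hy'
    have hxz' := hx' hx.1
    have hyz := hy' hy.1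
    obtain ⟨⟨a, ha, rfl⟩, hxz⟩ := hx
    obtain ⟨⟨b, hb, rfl⟩, hyz'⟩ := hy
    have hzz' : G.Adj z z' := by
      refine ht.isClique hz hz' ?_
      rintro rfl
      exact hxz' hxz
    have hne : p a ≠ p b := fun h ↦ hxz' (h ▸ hyz')
    have hna : ¬ G.Adj (p a) (p b) :=
      hst a (htZ ha) b (htZ hb) (ht.isClique ha hb fun h ↦ hne (congrArg p h))
    obtain ⟨c, hc, h1, h2⟩ := hG.exists_common_adj (A := {z, z'})
      (induce_pair_connected_of_adj hzz') hB
      (by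
        rintro c (rfl | rfl)
        · exact hZB _ (htZ hz)
        · exact hZB _ (htZ hz'))
      ⟨z, by simp, hxz⟩ ⟨z', by simp, hyz'⟩ (hpB a (htZ ha)) (hpB b (htZ hb)) hne hna
    rcases hc with rfl | rfl
    · exact hyz h2
    · exact hxz' h1
  refine hfree _ (ht.insert (a := p z) fun z' hz' ↦ ?_)
  have h1 : p z ∈ N z := by
    simp only [N, Finset.mem_filter]
    exact ⟨Finset.mem_image_of_mem p hz, hp z (htZ hz)⟩
  exact (Finset.mem_filter.1 (hsub z' hz' h1)).2

/-- The neighborhood of a vertex has smaller clique number. -/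
theorem CliqueFree.cliqueFreeOn_neighborSet {w : ℕ} (hfree : G.CliqueFree (w + 1)) (v : V) :
    G.CliqueFreeOn (G.neighborSet v) w := by
  classical
  intro t ht htc
  exact hfree _ (htc.insert (a := v) fun z hz ↦ ht hz)

/-- A coloring of an induced subgraph extends to a function on all vertices. -/
theorem exists_coloring_of_colorable_induce {S : Set V} {n : ℕ} [NeZero n]
    (h : (G.induce S).Colorable n) :
    ∃ col : V → Fin n, ∀ a ∈ S, ∀ b ∈ S, G.Adj a b → col a ≠ col b := by
  classical
  obtain ⟨c⟩ := h
  refine ⟨fun v ↦ if hv : v ∈ S then c ⟨v, hv⟩ else 0, fun a ha b hb hab ↦ ?_⟩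
  simp only [dif_pos ha, dif_pos hb]
  exact c.valid (v := ⟨a, ha⟩) (w := ⟨b, hb⟩) hab

/-- Let `C` be a connected set, anticomplete to a connected set `B`, and let `P` be a set of
vertices with neighbors in `B`. Given `u ∈ P` with a neighbor in `C`, for each component `D` of
`C` minus the neighbors of `u`, some neighbor of `u` in `C` is adjacent to every vertex of `P` that
has a neighbor in `D` and is not adjacent to `u`. -/
theorem NoLongHole.exists_attachment (hG : G.NoLongHole) {B C P : Set V} {u : V}
    (hB : (G.induce B).Connected) (hC : (G.induce C).Connected)
    (hCB : ∀ c ∈ C, ∀ b ∈ B, c ≠ b ∧ ¬ G.Adj c b)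
    (hPB : ∀ x ∈ P, ∃ b ∈ B, G.Adj x b) (hu : u ∈ P) (huC : ∃ c ∈ C, G.Adj u c)
    (c : (G.induce (C \ G.neighborSet u)).ConnectedComponent) :
    ∃ y, G.Adj u y ∧
      ∀ v ∈ c.supp, ∀ x ∈ P, G.Adj x v → ¬ G.Adj u x → G.Adj x y := by
  obtain ⟨c₀, hc₀, huc₀⟩ := huC
  let D : Set V := Subtype.val '' c.supp
  have hDC : D ⊆ C := by
    rintro _ ⟨x, _, rfl⟩
    exact x.2.1
  have hDu : ∀ d ∈ D, ¬ G.Adj u d := by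
    rintro _ ⟨x, _, rfl⟩
    exact x.2.2
  have hDconn : (G.induce D).Connected := connected_induce_image_supp c
  obtain ⟨⟨d₀, hd₀⟩⟩ := hDconn.nonempty
  obtain ⟨walk⟩ := hC.preconnected ⟨d₀, hDC hd₀⟩ ⟨c₀, hc₀⟩
  obtain ⟨e, -, he1, he2⟩ := walk.exists_boundary_dart (Subtype.val ⁻¹' D) hd₀
    (fun h ↦ hDu c₀ h huc₀)
  obtain ⟨⟨⟨d, hdC⟩, ⟨y, hyC⟩⟩, hdy⟩ := e
  have hdy : G.Adj d y := hdy
  have hd : d ∈ D := he1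
  have hyD : y ∉ D := he2
  have huy : G.Adj u y := by
    by_contra huy
    obtain ⟨x, hx, rfl⟩ := hd
    refine hyD ⟨⟨y, hyC, huy⟩, ?_, rfl⟩
    exact c.mem_supp_of_adj_mem_supp hx hdy
  refine ⟨y, huy, ?_⟩
  intro v hv x hx hxv hux
  have hvD : v.1 ∈ D := ⟨v, hv, rfl⟩
  have hAconn : (G.induce (D ∪ {y})).Connected :=
    connected_induce_union hDconn.preconnected Preconnected.of_subsingleton hd rfl hdy
  obtain ⟨a, ha, hua, hxa⟩ := hG.exists_common_adj hAconn hB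
    (by
      rintro a (ha | rfl)
      · exact hCB a (hDC ha)
      · exact hCB _ hyC)
    ⟨y, Or.inr rfl, huy⟩ ⟨v, Or.inl hvD, hxv⟩ (hPB u hu) (hPB x hx)
    (by
      rintro rfl
      exact hDu _ hvD hxv) hux
  rcases ha with ha | rfl
  · exact absurd hua (hDu a ha)
  · exact hxa

/-- A connected set which is anticomplete to a connected set `B`, and dominated by vertices having
neighbors in `B`, has chromatic number quadratic in that of the sets with smaller clique number. -/
theorem NoLongHole.colorable_of_dominated (hG : G.NoLongHole) {w n : ℕ} [NeZero n] (hw : 1 ≤ w)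
    (hfree : G.CliqueFree (w + 1))
    (hcol : ∀ S : Set V, G.CliqueFreeOn S w → (G.induce S).Colorable n) {B C P : Set V}
    (hB : (G.induce B).Connected) (hC : (G.induce C).Connected)
    (hCB : ∀ c ∈ C, ∀ b ∈ B, c ≠ b ∧ ¬ G.Adj c b)
    (hPB : ∀ x ∈ P, ∃ b ∈ B, G.Adj x b) (hCP : ∀ c ∈ C, ∃ x ∈ P, G.Adj x c) :
    (G.induce C).Colorable (2 * n * n) := by
  classical
  obtain ⟨⟨c₀, hc₀⟩⟩ := hC.nonempty
  obtain ⟨u, hu, huc₀⟩ := hCP c₀ hc₀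
  choose Y hY1 hY2 using hG.exists_attachment hB hC hCB hPB hu ⟨c₀, hc₀, huc₀⟩
  choose col hcol' using fun v ↦
    exists_coloring_of_colorable_induce (hcol _ (hfree.cliqueFreeOn_neighborSet v))
  choose! par hparP hparA using hCP
  let p : V → V := fun v ↦ if G.Adj u v then u else par v
  let y : V → V := fun v ↦ if hv : v ∈ C \ G.neighborSet u then
    Y ((G.induce (C \ G.neighborSet u)).connectedComponentMk ⟨v, hv⟩) else u
  let f : V → Fin n ⊕ Fin n := fun v ↦
    if G.Adj u v then Sum.inr 0
    else if G.Adj u (par v) then Sum.inl (col u (par v)) else Sum.inr (col (y v) (par v))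
  have hy : ∀ v ∈ C, ¬ G.Adj u v → ¬ G.Adj u (par v) → G.Adj (y v) (par v) := by
    intro v hv huv hup
    have hv' : v ∈ C \ G.neighborSet u := ⟨hv, huv⟩
    simp only [y, dif_pos hv']
    exact (hY2 _ ⟨v, hv'⟩ rfl _ (hparP v hv) (hparA v hv) hup).symm
  have hyy : ∀ v ∈ C, ∀ v' ∈ C, ¬ G.Adj u v → ¬ G.Adj u v' → G.Adj v v' → y v = y v' := by
    intro v hv v' hv' h1 h2 h
    have h1' : v ∈ C \ G.neighborSet u := ⟨hv, h1⟩
    have h2' : v' ∈ C \ G.neighborSet u := ⟨hv', h2⟩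
    simp only [y, dif_pos h1', dif_pos h2']
    congr 1
    exact ConnectedComponent.connectedComponentMk_eq_of_adj h
  have hmain := colorable_induce_of_partition (G := G) (C := C) (n := n) f fun i ↦ hcol _ <| by
    refine hG.cliqueFreeOn_of_cover hw hfree hB (fun z hz ↦ hCB z hz.1) p ?_ ?_ ?_
    · rintro z ⟨hz, -⟩
      by_cases h : G.Adj u z
      · simpa only [p, if_pos h] using h
      · simpa only [p, if_neg h] using hparA z hz
    · rintro z ⟨hz, -⟩
      by_cases h : G.Adj u z
      · simpa only [p, if_pos h] using hPB u hu
      · simpa only [p, if_neg h] using hPB _ (hparP z hz)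
    · rintro z ⟨hz, rfl⟩ z' ⟨hz', hff⟩ hzz'
      by_cases h : G.Adj u z <;> by_cases h' : G.Adj u z'
      · simp [p, h, h']
      · by_cases hq' : G.Adj u (par z')
        · simp [f, h, h', hq'] at hff
        · simpa [p, h, h'] using hq'
      · by_cases hq : G.Adj u (par z)
        · simp [f, h, h', hq] at hff
        · simpa [p, h, h', G.adj_comm] using hq
      · simp only [p, if_neg h, if_neg h']
        intro hpp
        by_cases hq : G.Adj u (par z) <;> by_cases hq' : G.Adj u (par z')
        · simp only [f, if_neg h, if_neg h', if_pos hq, if_pos hq', Sum.inl.injEq] at hff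
          exact hcol' u _ hq _ hq' hpp hff.symm
        · simp [f, h, h', hq, hq'] at hff
        · simp [f, h, h', hq, hq'] at hff
        · simp only [f, if_neg h, if_neg h', if_neg hq, if_neg hq', Sum.inr.injEq] at hff
          rw [← hyy z hz z' hz' h h' hzz'] at hff
          refine hcol' (y z) _ (hy z hz h hq) _ ?_ hpp hff.symm
          rw [hyy z hz z' hz' h h' hzz']
          exact hy z' hz' h' hq'
  simpa [two_mul] using hmain

/-- In a connected graph, every vertex at positive distance from `r` has a neighbor one step closer
to `r`. -/
theorem Connected.exists_adj_dist_eq (hconn : G.Connected) {r v : V} {k : ℕ}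
    (hv : G.dist r v = k + 1) : ∃ u, G.Adj u v ∧ G.dist r u = k := by
  obtain ⟨q, hq⟩ := hconn.exists_walk_length_eq_dist v r
  rw [dist_comm, hv] at hq
  cases q with
  | nil => simp at hq
  | cons h q =>
    rename_i u
    refine ⟨u, h.symm, ?_⟩
    have h1 := dist_le q
    have h2 := h.diff_dist_adj (u := r)
    rw [dist_comm] at h1
    simp only [Walk.length_cons] at hq
    omega

/-- Balls in a connected graph are connected. -/
theorem Connected.connected_induce_dist_lt (hconn : G.Connected) (r : V) (k : ℕ) :
    (G.induce {v | G.dist r v < k + 1}).Connected := by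
  rw [connected_iff_exists_forall_reachable]
  refine ⟨⟨r, by simp⟩, ?_⟩
  suffices ∀ m v, (hv : G.dist r v < k + 1) → G.dist r v = m →
      (G.induce {v | G.dist r v < k + 1}).Reachable ⟨r, by simp⟩ ⟨v, hv⟩ from
    fun v ↦ this _ v.1 v.2 rfl
  intro m
  induction m with
  | zero =>
    intro v hv h0
    obtain rfl := hconn.dist_eq_zero_iff.1 h0
    exact Reachable.refl _
  | succ m ih =>
    intro v hv hm
    obtain ⟨u, huv, hu⟩ := hconn.exists_adj_dist_eq hm
    have hu' : G.dist r u < k + 1 := by omega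
    have hadj : (G.induce {v | G.dist r v < k + 1}).Adj ⟨u, hu'⟩ ⟨v, hv⟩ := huv
    exact (ih u hu' hu).trans hadj.reachable

/-- Each distance level of a connected graph without long holes is colorable. -/
theorem NoLongHole.colorable_level (hG : G.NoLongHole) (hconn : G.Connected) {w n : ℕ} [NeZero n]
    (hw : 1 ≤ w) (hfree : G.CliqueFree (w + 1))
    (hcol : ∀ S : Set V, G.CliqueFreeOn S w → (G.induce S).Colorable n) (r : V) (k : ℕ) :
    (G.induce {v | G.dist r v = k}).Colorable (2 * n * n) := by
  have hn : 0 < n := Nat.pos_of_neZero n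
  rcases k with _ | _ | k
  · have : Subsingleton {v | G.dist r v = 0} := by
      refine ⟨fun a b ↦ Subtype.ext ?_⟩
      rw [← hconn.dist_eq_zero_iff.1 a.2, ← hconn.dist_eq_zero_iff.1 b.2]
    have h1 : (G.induce {v | G.dist r v = 0}).Colorable 1 :=
      ⟨Coloring.mk (fun _ ↦ 0) fun {a b} h ↦ absurd (Subsingleton.elim a b) h.ne⟩
    exact h1.mono (by nlinarith)
  · refine (hcol _ ?_).mono (show n ≤ 2 * n * n by nlinarith)
    exact CliqueFreeOn.subset (G := G) (fun v hv ↦ dist_eq_one_iff_adj.1 hv)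
      (hfree.cliqueFreeOn_neighborSet r)
  · refine colorable_induce_of_components fun c ↦ ?_
    have hlev : ∀ v ∈ Subtype.val '' c.supp, G.dist r v = k + 2 := by
      rintro _ ⟨x, -, rfl⟩
      exact x.2
    refine hG.colorable_of_dominated hw hfree hcol (B := {v | G.dist r v < k + 1})
      (P := {v | G.dist r v = k + 1}) (hconn.connected_induce_dist_lt r k)
      (connected_induce_image_supp c) ?_ ?_ ?_
    · intro v hv b hb
      have hv := hlev v hv
      have hb : G.dist r b < k + 1 := hb
      refine ⟨?_, fun h ↦ ?_⟩
      · rintro rfl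
        omega
      · have := h.diff_dist_adj (u := r)
        omega
    · intro x hx
      obtain ⟨b, hb, hbk⟩ := hconn.exists_adj_dist_eq hx
      exact ⟨b, hbk.trans_lt (Nat.lt_succ_self k), hb.symm⟩
    · intro v hv
      obtain ⟨x, hx, hxk⟩ := hconn.exists_adj_dist_eq (hlev v hv)
      exact ⟨x, hxk, hx⟩

/-- A connected graph without long holes has chromatic number quadratic in that of its induced
subgraphs with smaller clique number. -/
theorem NoLongHole.colorable_of_connected (hG : G.NoLongHole) (hconn : G.Connected) {w n : ℕ}
    [NeZero n] (hw : 1 ≤ w) (hfree : G.CliqueFree (w + 1))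
    (hcol : ∀ S : Set V, G.CliqueFreeOn S w → (G.induce S).Colorable n) :
    G.Colorable (4 * n ^ 2) := by
  obtain ⟨r⟩ := hconn.nonempty
  have : NeZero (2 * n * n) := ⟨by simp [NeZero.ne n]⟩
  choose col hcol' using fun k ↦
    exists_coloring_of_colorable_induce (hG.colorable_level hconn hw hfree hcol r k)
  let c : G.Coloring (ZMod 2 × Fin (2 * n * n)) := Coloring.mk
    (fun v ↦ ((G.dist r v : ZMod 2), col (G.dist r v) v)) (by
      intro v v' h heq
      simp only [Prod.mk.injEq] at heq
      have h1 := (ZMod.natCast_eq_natCast_iff' _ _ _).1 heq.1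
      have h2 := h.diff_dist_adj (u := r)
      have h3 : G.dist r v' = G.dist r v := by omega
      rw [h3] at heq
      exact hcol' (G.dist r v) v rfl v' h3 h heq.2)
  refine c.colorable.mono (le_of_eq ?_)
  simp only [Fintype.card_prod, ZMod.card, Fintype.card_fin]
  ring

/-- A graph without long holes and with clique number at most `w ≥ 1` is
`2 ^ (2 ^ w - 2)`-colorable. -/
theorem NoLongHole.colorable {w : ℕ} (hw : 1 ≤ w) {V : Type u} {G : SimpleGraph V}
    (hG : G.NoLongHole) (hfree : G.CliqueFree (w + 1)) : G.Colorable (2 ^ (2 ^ w - 2)) := by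
  induction w, hw using Nat.le_induction generalizing V with
  | base =>
    rw [cliqueFree_two.1 hfree]
    exact ⟨Coloring.mk (fun _ ↦ 0) fun h ↦ h.elim⟩
  | succ w hw ih =>
    have hexp : 2 ^ (2 ^ (w + 1) - 2) = 4 * (2 ^ (2 ^ w - 2)) ^ 2 := by
      have h2 : 2 ^ 1 ≤ 2 ^ w := Nat.pow_le_pow_right (by norm_num) hw
      rw [← pow_mul, show 4 = 2 ^ 2 by norm_num, ← pow_add, pow_succ 2 w]
      congr 1
      omega
    rw [hexp, colorable_iff_forall_connectedComponent]
    intro c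
    refine NoLongHole.colorable_of_connected (hG.induce _) c.connected_toSimpleGraph
      (w := w + 1) (by omega) (hfree.comap (Embedding.induce _).isContained) fun S hS ↦ ?_
    exact ih ((hG.induce _).induce S) ((cliqueFree_induce_iff _ _ _).2 hS)

end SimpleGraph

/-- If `G` has no induced cycle of length at least 5, then `χ(G) ≤ 2 ^ (2 ^ ω(G))`. -/
theorem stmt_1 (V : Type) [Fintype V] (G : SimpleGraph V)
    (h : ∀ (ℓ : ℕ) (s : Set V), 5 ≤ ℓ → ¬ Nonempty (G.induce s ≃g cycleGraph ℓ)) :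
    chi G ≤ 2 ^ (2 ^ G.cliqueNum) := by
  have hG : G.NoLongHole := by
    refine fun ℓ hℓ ↦ ⟨fun f ↦ h ℓ (Set.range f) hℓ ⟨?_⟩⟩
    exact (Embedding.isoInduceRange f).symm
  have hfree : G.CliqueFree (G.cliqueNum + 1) := by
    intro t ht
    have h1 := ht.isClique.card_le_cliqueNum
    have h2 := ht.card_eq
    omega
  refine Nat.sInf_le ?_
  change G.Colorable _
  rcases Nat.eq_zero_or_pos G.cliqueNum with h0 | hpos
  · have h1 := hG.colorable le_rfl (hfree.mono (by omega))
    exact h1.mono (Nat.pow_le_pow_right (by norm_num) (by simp))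
  · exact (hG.colorable hpos hfree).mono
      (Nat.pow_le_pow_right (by norm_num) (Nat.sub_le _ _))
end

section
/- Let G be a nonempty finite simple graph with at least one vertex. Then χ(G) ≤ χ_p(G) · ω(G), i.e., the chromatic number is at most the perfect chromatic number times the clique number. -/
open SimpleGraph

theorem chi_le_of_colorable {V : Type*} {G : SimpleGraph V} {n : ℕ} (h : G.Colorable n) :
    chi G ≤ n :=
  Nat.sInf_le h

theorem colorable_chi {V : Type*} [Finite V] (G : SimpleGraph V) : G.Colorable (chi G) := by
  have := Fintype.ofFinite V
  exact Nat.sInf_mem (s := {n | G.Colorable n}) ⟨_, G.colorable_of_fintype⟩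

theorem cliqueNum_le_chi {V : Type*} [Finite V] (G : SimpleGraph V) : G.cliqueNum ≤ chi G := by
  obtain ⟨s, hs⟩ := G.exists_isNClique_cliqueNum
  exact hs.card_eq ▸ hs.isClique.card_le_of_colorable (colorable_chi G)

theorem chi_eq_cliqueNum_of_subsingleton {V : Type*} [Finite V] [Subsingleton V]
    (G : SimpleGraph V) : chi G = G.cliqueNum := by
  have := Fintype.ofFinite V
  have hclique : G.IsClique ((Finset.univ : Finset V) : Set V) :=
    fun a _ b _ hab => (hab (Subsingleton.elim a b)).elim
  exact le_antisymm
    ((chi_le_of_colorable G.colorable_of_fintype).trans hclique.card_le_cliqueNum)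
    (cliqueNum_le_chi G)

theorem isPerfect_of_subsingleton {V : Type*} [Finite V] [Subsingleton V]
    (G : SimpleGraph V) : IsPerfect G :=
  fun _ => chi_eq_cliqueNum_of_subsingleton _

theorem exists_perfect_partition_chiP {V : Type*} [Finite V] (G : SimpleGraph V) :
    ∃ f : V → Fin (chiP G), ∀ i, IsPerfect (G.induce (f ⁻¹' {i})) := by
  have := Fintype.ofFinite V
  refine Nat.sInf_mem (s := {k | ∃ f : V → Fin k, ∀ i, IsPerfect (G.induce (f ⁻¹' {i}))})
    ⟨Fintype.card V, Fintype.equivFin V, fun i => ?_⟩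
  have : Subsingleton ↥(Fintype.equivFin V ⁻¹' {i}) :=
    ⟨fun a b => Subtype.ext ((Fintype.equivFin V).injective (a.2.trans b.2.symm))⟩
  exact isPerfect_of_subsingleton _

theorem IsPerfect.colorable_cliqueNum {V : Type*} [Finite V] {G : SimpleGraph V}
    (h : IsPerfect G) : G.Colorable G.cliqueNum :=
  ((colorable_chi (G.induce Set.univ)).mono
    ((h Set.univ).le.trans (cliqueNum_induce_le _))).of_hom (induceUnivIso G).symm.toHom

theorem colorable_mul_of_fibers {V : Type*} {G : SimpleGraph V} {k n : ℕ} (f : V → Fin k)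
    (h : ∀ i, (G.induce (f ⁻¹' {i})).Colorable n) : G.Colorable (k * n) := by
  let c (i : Fin k) : (G.induce (f ⁻¹' {i})).Coloring (Fin n) := (h i).some
  have hfiber (w : V) (i : Fin k) (hi : f w = i) : c (f w) ⟨w, rfl⟩ = c i ⟨w, hi⟩ := by
    subst hi
    rfl
  let C : G.Coloring (Fin k × Fin n) := Coloring.mk (fun v => (f v, c (f v) ⟨v, rfl⟩)) <| by
    intro v w hvw heq
    obtain ⟨hf, hc⟩ := Prod.mk.inj heq
    have hadj : (G.induce (f ⁻¹' {f v})).Adj ⟨v, rfl⟩ ⟨w, hf.symm⟩ := hvw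
    exact (c (f v)).valid hadj (hc.trans (hfiber w (f v) hf.symm))
  simpa using C.colorable

/-- For a nonempty finite graph, `χ(G) ≤ χ_p(G) * ω(G)`. -/
theorem stmt_2 (V : Type) [Fintype V] [Nonempty V] (G : SimpleGraph V) :
    chi G ≤ chiP G * G.cliqueNum := by
  obtain ⟨f, hf⟩ := exists_perfect_partition_chiP G
  exact chi_le_of_colorable <| colorable_mul_of_fibers f fun i =>
    (hf i).colorable_cliqueNum.mono (cliqueNum_induce_le _)
end

section
/- Let G be a finite simple triangle-free graph. Then χ_p(G) = ⌈χ(G)/2⌉. -/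
open SimpleGraph

/-- A finite graph is `n`-colourable iff its chromatic number is at most `n`. -/
theorem colorable_iff_chi_le {V : Type*} [Finite V] (G : SimpleGraph V) (n : ℕ) :
    G.Colorable n ↔ chi G ≤ n := by
  have := Fintype.ofFinite V
  refine ⟨fun h => Nat.sInf_le h, fun h => ?_⟩
  have hne : {n | G.Colorable n}.Nonempty := ⟨_, G.colorable_of_fintype⟩
  have hmem : G.Colorable (chi G) := Nat.sInf_mem hne
  exact hmem.mono h

theorem cliqueNum_le_of_colorable {V : Type*} [Finite V] {G : SimpleGraph V} {n : ℕ}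
    (h : G.Colorable n) : G.cliqueNum ≤ n := by
  obtain ⟨s, hs⟩ := G.exists_isNClique_cliqueNum
  exact hs.card_eq ▸ hs.isClique.card_le_of_colorable h

/-- A finite bipartite graph has equal chromatic and clique numbers. -/
theorem chi_eq_cliqueNum_of_colorable_two {V : Type*} [Finite V] {G : SimpleGraph V}
    (h : G.Colorable 2) : chi G = G.cliqueNum := by
  classical
  have := Fintype.ofFinite V
  refine le_antisymm ?_ (cliqueNum_le_of_colorable ((colorable_iff_chi_le G _).2 le_rfl))
  by_cases hadj : ∃ a b, G.Adj a b
  · obtain ⟨a, b, hab⟩ := hadj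
    have hc : G.IsClique (({a, b} : Finset V) : Set V) := by
      simp [hab]
    have hle := hc.card_le_cliqueNum
    rw [Finset.card_pair hab.ne] at hle
    exact ((colorable_iff_chi_le G 2).1 h).trans hle
  · push Not at hadj
    rcases isEmpty_or_nonempty V with hV | ⟨⟨a⟩⟩
    · exact ((colorable_iff_chi_le G 0).1 (Colorable.of_isEmpty 0)).trans (Nat.zero_le _)
    · have hc : G.IsClique (({a} : Finset V) : Set V) := by simp
      have hle := hc.card_le_cliqueNum
      rw [Finset.card_singleton] at hle
      have h1 : G.Colorable 1 := ⟨Coloring.mk (fun _ => 0) fun {v w} hvw => (hadj v w hvw).elim⟩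
      exact ((colorable_iff_chi_le G 1).1 h1).trans hle

theorem isPerfect_of_colorable_two {V : Type*} [Finite V] {G : SimpleGraph V}
    (h : G.Colorable 2) : IsPerfect G := fun s =>
  chi_eq_cliqueNum_of_colorable_two (h.of_hom (Embedding.induce s).toHom)

/-- A finite triangle-free perfect graph is bipartite. -/
theorem IsPerfect.colorable_two {V : Type*} [Finite V] {G : SimpleGraph V}
    (h : IsPerfect G) (htf : G.CliqueFree 3) : G.Colorable 2 := by
  have hcf : (G.induce Set.univ).CliqueFree 3 := htf.comap ⟨(Embedding.induce _).toCopy⟩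
  have hle : (G.induce Set.univ).cliqueNum ≤ 2 := by
    obtain ⟨s, hs⟩ := (G.induce Set.univ).exists_isNClique_cliqueNum
    by_contra! hlt
    exact (hcf.mono hlt) s hs
  have hcol := (colorable_iff_chi_le (G.induce Set.univ) 2).2 ((h Set.univ).trans_le hle)
  exact hcol.of_hom (induceUnivIso G).symm.toHom

/-- A finite triangle-free graph splits into `k` perfect sets iff it is `2 * k`-colourable. -/
theorem exists_perfect_partition_iff {V : Type*} [Finite V] {G : SimpleGraph V}
    (htf : G.CliqueFree 3) (k : ℕ) :
    (∃ f : V → Fin k, ∀ i, IsPerfect (G.induce (f ⁻¹' {i}))) ↔ G.Colorable (2 * k) := by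
  constructor
  · rintro ⟨f, hf⟩
    have c (i : Fin k) := ((hf i).colorable_two (htf.comap ⟨(Embedding.induce _).toCopy⟩)).some
    have C : G.Coloring (Fin k × Fin 2) :=
      Coloring.mk (fun v => (f v, c (f v) ⟨v, rfl⟩)) fun {v w} hvw heq => by
        obtain ⟨h1, h2⟩ := Prod.mk.inj heq
        have hcw (i : Fin k) (hi : f w = i) : c (f w) ⟨w, rfl⟩ = c i ⟨w, hi⟩ := by
          subst hi
          rfl
        exact (c (f v)).valid (v := ⟨v, rfl⟩) (w := ⟨w, h1.symm⟩) hvw (h2.trans (hcw _ h1.symm))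
    simpa [mul_comm] using C.colorable
  · intro h
    have C : G.Coloring (Fin k × Fin 2) := h.toColoring (by simp [mul_comm])
    refine ⟨fun v => (C v).1, fun i => isPerfect_of_colorable_two
      ⟨Coloring.mk (fun v => (C v.1).2) fun {v w} hvw heq => ?_⟩⟩
    exact C.valid hvw (Prod.ext (v.2.trans w.2.symm) heq)

/-- For a finite triangle-free graph, `χ_p(G) = ⌈χ(G) / 2⌉`. -/
theorem stmt_4 (V : Type) [Fintype V] (G : SimpleGraph V) (htf : G.CliqueFree 3) :
    chiP G = (chi G + 1) / 2 := by
  have hset : {k | ∃ f : V → Fin k, ∀ i, IsPerfect (G.induce (f ⁻¹' {i}))} =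
      Set.Ici ((chi G + 1) / 2) := by
    ext k
    rw [Set.mem_ofPred_eq, exists_perfect_partition_iff htf, colorable_iff_chi_le, Set.mem_Ici]
    omega
  rw [chiP, hset, csInf_Ici]
end

section
/- Every line graph is nice. That is, for every finite simple graph G, the line graph L(G) satisfies: every induced subgraph H of L(G) satisfies χ(H) − ω(H) ∈ {0, 1}. -/
open SimpleGraph

namespace SimpleGraph

variable {V C : Type*}

/-- `c` is a proper edge colouring of `H`, as a symmetric function on pairs of vertices taking the
value `none` exactly at the non-edges. -/
structure IsEdgeColoring (H : SimpleGraph V) (c : V → V → Option C) : Prop where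
  symm : ∀ u v, c u v = c v u
  proper : ∀ {u v w a}, c u v = some a → c u w = some a → v = w
  eq_none_iff : ∀ {u v}, c u v = none ↔ ¬ H.Adj u v

/-- The colour `a` does not occur at the vertex `v`. -/
def IsMissing (c : V → V → Option C) (v : V) (a : C) : Prop :=
  ∀ w, c v w ≠ some a

namespace IsEdgeColoring

variable {H : SimpleGraph V} {c : V → V → Option C}

lemma adj (h : IsEdgeColoring H c) {u v : V} {a : C} (e : c u v = some a) : H.Adj u v := by
  by_contra hn
  simp [h.eq_none_iff.2 hn] at e

open Classical in
lemma recolor (h : IsEdgeColoring H c) {x y : V} (hxy : x ≠ y) {γ : C}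
    (hx : IsMissing c x γ) (hy : IsMissing c y γ) :
    IsEdgeColoring (H ⊔ edge x y) (fun u v => if s(u, v) = s(x, y) then some γ else c u v) where
  symm u v := by rw [Sym2.eq_swap, h.symm u v]
  proper {u v w a} h1 h2 := by
    have hp := @h.proper u v w a
    have hxw := hx w
    have hyw := hy w
    have hxv := hx v
    have hyv := hy v
    simp only [Sym2.eq_iff] at h1 h2
    grind
  eq_none_iff {u v} := by
    have := @h.eq_none_iff u v
    simp only [sup_adj, edge_adj, Sym2.eq_iff]
    grind

lemma exists_isMissing [Fintype V] [Fintype C] (h : IsEdgeColoring H c) (v : V)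
    [Fintype (H.neighborSet v)] (hv : H.degree v < Fintype.card C) : ∃ a, IsMissing c v a := by
  by_contra! hn
  simp only [IsMissing, not_forall, not_not] at hn
  choose f hf using hn
  have hinj : Function.Injective f := fun a b hab => by
    have h1 := hf a
    rw [hab, hf b] at h1
    exact (Option.some.inj h1).symm
  have := Finset.card_le_card_of_injOn (s := Finset.univ) (t := H.neighborFinset v) f
    (fun a _ => by simpa using h.adj (hf a)) hinj.injOn
  rw [card_neighborFinset_eq_degree, Finset.card_univ] at this
  omega

/-- If some colour is missing at `x` and at the end of a fan starting with the non-edge `xy`, then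
shifting the colours along the fan extends the colouring to `xy`. -/
lemma exists_of_fan {x y : V} (hxy : x ≠ y) (n : ℕ) :
    ∀ (c : V → V → Option C) (p : ℕ → V) (γ : C), IsEdgeColoring H c → p 0 = y →
      (∀ i < n, ∃ a, c x (p (i + 1)) = some a ∧ IsMissing c (p i) a) →
      IsMissing c x γ → IsMissing c (p n) γ →
      ∃ c' : V → V → Option C, IsEdgeColoring (H ⊔ edge x y) c' := by
  classical
  induction n using Nat.strong_induction_on with
  | _ n ih =>
  intro c p γ h h0 hp hx hn
  obtain _ | n := n
  · exact ⟨_, h.recolor hxy hx (h0 ▸ hn)⟩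
  obtain ⟨a, ha, hma⟩ := hp n (by omega)
  by_cases hj : ∃ j ≤ n, p j = p (n + 1)
  · obtain ⟨j, hjn, hj⟩ := hj
    exact ih j (by omega) c p γ h h0 (fun i hi => hp i (by omega)) hx (hj ▸ hn)
  push Not at hj
  have hxz := h.adj ha
  have hpx : ∀ i ≤ n, p i ≠ x := by
    rintro (_ | i) hi
    · exact h0 ▸ hxy.symm
    · obtain ⟨b, hb, -⟩ := hp i (by omega)
      exact (h.adj hb).ne'
  have h' := h.recolor hxz.ne hx hn
  rw [sup_edge_of_adj _ hxz] at h'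
  have hmiss : ∀ i ≤ n, ∀ b, IsMissing c (p i) b → IsMissing (fun u v =>
      if s(u, v) = s(x, p (n + 1)) then some γ else c u v) (p i) b := by
    intro i hi b hb w
    have := hpx i hi
    have := hj i hi
    have := hb w
    simp only [Sym2.eq_iff]
    grind
  refine ih n (by omega) _ p a h' h0 (fun i hi => ?_) (fun w => ?_) (hmiss n le_rfl a hma)
  · obtain ⟨b, hb, hmb⟩ := hp i (by omega)
    refine ⟨b, ?_, hmiss i hi.le b hmb⟩
    have := hj (i + 1) (by omega)
    have := hxz.ne
    simp only [Sym2.eq_iff]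
    grind
  · have := hx (p (n + 1))
    have := @h.proper x w (p (n + 1)) a
    simp only [Sym2.eq_iff]
    grind

/-- The subgraph of edges coloured `α` or `β`. -/
def kempe (h : IsEdgeColoring H c) (α β : C) : SimpleGraph V where
  Adj u v := c u v = some α ∨ c u v = some β
  symm := ⟨fun u v huv => by rwa [h.symm v u]⟩
  loopless := ⟨fun u hu => by rcases hu with hu | hu <;> exact (h.adj hu).ne rfl⟩

@[simp]
lemma kempe_adj (h : IsEdgeColoring H c) {α β : C} {u v : V} :
    (h.kempe α β).Adj u v ↔ c u v = some α ∨ c u v = some β :=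
  Iff.rfl

open Classical in
lemma swap (h : IsEdgeColoring H c) {α β : C} {K : Set V}
    (hK : ∀ u v, (h.kempe α β).Adj u v → u ∈ K → v ∈ K) :
    IsEdgeColoring H (fun u v => if u ∈ K then (c u v).map (Equiv.swap α β) else c u v) where
  symm u v := by
    have h1 := hK u v
    have h2 := hK v u
    simp only [kempe_adj, ← h.symm u v] at h1 h2 ⊢
    cases hc : c u v with
    | none => simp
    | some a =>
      simp only [Option.map_some, hc, Option.some.injEq] at h1 h2 ⊢
      have := Equiv.swap_apply_of_ne_of_ne (a := α) (b := β) (x := a)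
      grind
  proper {u v w a} h1 h2 := by
    by_cases hu : u ∈ K
    · simp only [hu, if_true, Option.map_eq_some_iff] at h1 h2
      obtain ⟨b, hb, rfl⟩ := h1
      obtain ⟨b', hb', hbb⟩ := h2
      rw [(Equiv.swap α β).injective hbb] at hb'
      exact h.proper hb hb'
    · simp only [hu, if_false] at h1 h2
      exact h.proper h1 h2
  eq_none_iff {u v} := by
    rw [← h.eq_none_iff]
    split_ifs <;> simp

lemma kempe_degree_le [Fintype V] (h : IsEdgeColoring H c) (α β : C) (v : V)
    [Fintype ((h.kempe α β).neighborSet v)] : (h.kempe α β).degree v ≤ 2 := by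
  classical
  have hc (a : C) : (Finset.univ.filter fun w => c v w = some a).card ≤ 1 :=
    Finset.card_le_one.2 fun u hu w hw =>
      h.proper (Finset.mem_filter.1 hu).2 (Finset.mem_filter.1 hw).2
  have hs : (h.kempe α β).neighborFinset v ⊆ (Finset.univ.filter fun w => c v w = some α) ∪
      (Finset.univ.filter fun w => c v w = some β) := by
    intro w hw
    simpa using hw
  rw [← card_neighborFinset_eq_degree]
  linarith [Finset.card_le_card hs, hc α, hc β, Finset.card_union_le
    (Finset.univ.filter fun w => c v w = some α) (Finset.univ.filter fun w => c v w = some β)]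

lemma kempe_degree_le_one [Fintype V] (h : IsEdgeColoring H c) {α β : C} {v : V}
    [Fintype ((h.kempe α β).neighborSet v)] (hv : IsMissing c v α ∨ IsMissing c v β) :
    (h.kempe α β).degree v ≤ 1 := by
  classical
  rw [← card_neighborFinset_eq_degree]
  refine Finset.card_le_one.2 fun u hu w hw => ?_
  simp only [mem_neighborFinset, kempe_adj] at hu hw
  rcases hv with hv | hv
  · exact h.proper (hu.resolve_left (hv u)) (hw.resolve_left (hv w))
  · exact h.proper (hu.resolve_right (hv u)) (hw.resolve_right (hv w))

end IsEdgeColoring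

/-- A connected graph of maximum degree two has at most two vertices of degree at most one. -/
lemma Connected.not_three_degree_le_one [Fintype V] {K : SimpleGraph V} [DecidableRel K.Adj]
    (hK : K.Connected) (h2 : ∀ v, K.degree v ≤ 2) {x y z : V} (hxy : x ≠ y) (hxz : x ≠ z)
    (hyz : y ≠ z) (hx : K.degree x ≤ 1) (hy : K.degree y ≤ 1) (hz : K.degree z ≤ 1) : False := by
  classical
  have hcard := hK.card_vert_le_card_edgeSet_add_one
  rw [Nat.card_eq_fintype_card, Nat.card_eq_fintype_card, ← edgeFinset_card] at hcard
  have hsum := K.sum_degrees_eq_twice_card_edges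
  have hle : ∑ v, (K.degree v + if v ∈ ({x, y, z} : Finset V) then 1 else 0) ≤ ∑ _v : V, 2 := by
    refine Finset.sum_le_sum fun v _ => ?_
    split_ifs with hv
    · simp only [Finset.mem_insert, Finset.mem_singleton] at hv
      rcases hv with rfl | rfl | rfl <;> omega
    · exact h2 v
  have h3 : ({x, y, z} : Finset V).card = 3 := Finset.card_eq_three.2 ⟨x, y, z, hxy, hxz, hyz, rfl⟩
  rw [Finset.sum_add_distrib, Finset.sum_boole, Finset.filter_mem_eq_inter, Finset.univ_inter, h3,
    Finset.sum_const, Finset.card_univ] at hle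
  simp at hle
  omega

/-- In a graph of maximum degree two, a component has at most two vertices of degree at most
one. -/
lemma not_three_reachable_degree_le_one [Fintype V] {K : SimpleGraph V} [DecidableRel K.Adj]
    (h2 : ∀ v, K.degree v ≤ 2) {x y z : V} (hxy : x ≠ y) (hxz : x ≠ z) (hyz : y ≠ z)
    (hx : K.degree x ≤ 1) (hy : K.degree y ≤ 1) (hz : K.degree z ≤ 1)
    (hrxy : K.Reachable x y) (hrxz : K.Reachable x z) : False := by
  classical
  let D := K.connectedComponentMk x
  have hdeg (v : D) : D.toSimpleGraph.degree v ≤ K.degree v := by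
    rw [← card_neighborFinset_eq_degree, ← card_neighborFinset_eq_degree]
    refine Finset.card_le_card_of_injOn Subtype.val (fun w hw => ?_) Subtype.val_injective.injOn
    rw [Finset.mem_coe, mem_neighborFinset] at hw ⊢
    exact (D.toSimpleGraph_adj v.2 w.2).1 hw
  refine D.connected_toSimpleGraph.not_three_degree_le_one (fun v => (hdeg v).trans (h2 v))
    (x := ⟨x, rfl⟩) (y := ⟨y, ConnectedComponent.sound hrxy.symm⟩)
    (z := ⟨z, ConnectedComponent.sound hrxz.symm⟩) (mt (congrArg Subtype.val) hxy)
    (mt (congrArg Subtype.val) hxz) (mt (congrArg Subtype.val) hyz)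
    ((hdeg _).trans hx) ((hdeg _).trans hy) ((hdeg _).trans hz)

namespace IsEdgeColoring

variable {H : SimpleGraph V} {c : V → V → Option C}

/-- If the colouring does not extend to `xy`, then each vertex `p n` of a fan at `xy` lies in the
Kempe chain of `x` for any colours missing at `x` and at `p n`. -/
lemma kempe_reachable_of_fan (h : IsEdgeColoring H c) {x y : V} (hxy : x ≠ y)
    (hne : ¬ ∃ c' : V → V → Option C, IsEdgeColoring (H ⊔ edge x y) c')
    {p : ℕ → V} (h0 : p 0 = y) {α β : C} (hx : IsMissing c x α) (n : ℕ)
    (hp : ∀ i < n, ∃ a, c x (p (i + 1)) = some a ∧ IsMissing c (p i) a)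
    (hn : IsMissing c (p n) β) : (h.kempe α β).Reachable x (p n) := by
  classical
  induction n using Nat.strong_induction_on with
  | _ n ih =>
  by_contra hr
  have h' := h.swap (α := α) (β := β) (K := {w | (h.kempe α β).Reachable (p n) w})
    (fun u v huv hu => Reachable.trans hu huv.reachable)
  have hxK : x ∉ {w | (h.kempe α β).Reachable (p n) w} := fun hm => hr hm.symm
  refine hne (exists_of_fan hxy n _ p α h' h0 (fun i hi => ?_) (fun w => ?_) fun w => ?_)
  · obtain ⟨a, ha, hm⟩ := hp i hi
    refine ⟨a, by simpa only [hxK, if_false] using ha, fun w => ?_⟩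
    beta_reduce
    split_ifs with hK
    · have haα : a ≠ α := by
        rintro rfl
        exact hx _ ha
      have haβ : a ≠ β := by
        rintro rfl
        exact hr ((ih i hi (fun j hj => hp j (by omega)) hm).trans (Reachable.symm hK))
      rw [Ne, Option.map_eq_some_iff]
      rintro ⟨b, hb, hba⟩
      rw [Equiv.swap_apply_eq_iff, Equiv.swap_apply_of_ne_of_ne haα haβ] at hba
      exact hm w (hba ▸ hb)
    · exact hm w
  · simpa only [hxK, if_false] using hx w
  · have : p n ∈ {w | (h.kempe α β).Reachable (p n) w} := Reachable.refl _
    simp only [this, if_true, Ne, Option.map_eq_some_iff]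
    rintro ⟨b, hb, hba⟩
    rw [Equiv.swap_apply_eq_iff, Equiv.swap_apply_left] at hba
    exact hn w (hba ▸ hb)

/-- An edge colouring for which every vertex misses a colour can be modified so as to extend to
one more edge. -/
lemma exists_sup_edge [Finite V] (h : IsEdgeColoring H c) (hmiss : ∀ v, ∃ a, IsMissing c v a)
    {x y : V} (hxy : x ≠ y) (hn : ¬ H.Adj x y) :
    ∃ c' : V → V → Option C, IsEdgeColoring (H ⊔ edge x y) c' := by
  classical
  have := Fintype.ofFinite V
  by_contra hne
  choose m hm using hmiss
  let S : Set V := {z | ∃ (n : ℕ) (p : ℕ → V), p 0 = y ∧ p n = z ∧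
    ∀ i < n, ∃ a, c x (p (i + 1)) = some a ∧ IsMissing c (p i) a}
  have hyS : y ∈ S := ⟨0, fun _ => y, rfl, rfl, by simp⟩
  have hxS : x ∉ S := by
    rintro ⟨_ | n, p, h0, hpn, hp⟩
    · exact hxy (hpn.symm.trans h0)
    · obtain ⟨a, ha, -⟩ := hp n (by omega)
      exact (h.adj ha).ne hpn.symm
  have hstep : ∀ z ∈ S, ∀ w a, c x w = some a → IsMissing c z a → w ∈ S := by
    rintro z ⟨n, p, h0, rfl, hp⟩ w a hw ha
    refine ⟨n + 1, fun i => if i ≤ n then p i else w, by simpa, by simp, fun i hi => ?_⟩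
    rcases (Nat.lt_succ_iff.1 hi).lt_or_eq with hi | rfl
    · simpa [hi.le, Nat.succ_le_iff, hi] using hp i hi
    · exact ⟨a, by simpa using hw, by simpa using ha⟩
  have hpres : ∀ z ∈ S, ∃ w, c x w = some (m z) := by
    rintro z ⟨n, p, h0, rfl, hp⟩
    by_contra! hx
    exact hne (exists_of_fan hxy n c p _ h h0 hp hx (hm _))
  have hreach : ∀ z ∈ S, ∀ β, IsMissing c z β → (h.kempe (m x) β).Reachable x z := by
    rintro z ⟨n, p, h0, rfl, hp⟩ β hβ
    exact h.kempe_reachable_of_fan hxy hne h0 (hm x) n hp hβ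
  have hinj : Set.InjOn m S := by
    intro z hz w hw hzw
    by_contra hzw'
    exact not_three_reachable_degree_le_one (K := h.kempe (m x) (m z))
      (fun _ => h.kempe_degree_le _ _ _) (ne_of_mem_of_not_mem hz hxS).symm
      (ne_of_mem_of_not_mem hw hxS).symm hzw'
      (h.kempe_degree_le_one (.inl (hm x))) (h.kempe_degree_le_one (.inr (hm z)))
      (h.kempe_degree_le_one (.inr (hzw ▸ hm w))) (hreach z hz _ (hm z))
      (hreach w hw _ (hzw ▸ hm w))
  choose! f hf using hpres
  have hfS : Set.MapsTo f S S := fun z hz => hstep z hz _ _ (hf z hz) (hm z)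
  have hfinj : Set.InjOn f S := fun z hz w hw hzw => hinj hz hw <| by
    have := hf z hz
    rw [hzw, hf w hw] at this
    exact (Option.some.inj this).symm
  obtain ⟨z, hz, hzy⟩ := ((S.toFinite.injOn_iff_bijOn_of_mapsTo hfS).1 hfinj).surjOn hyS
  exact hn (h.adj (hzy ▸ hf z hz))

end IsEdgeColoring

/-- **Vizing's theorem**: a finite graph has a proper edge colouring with any number of colours
exceeding all its degrees. -/
theorem exists_isEdgeColoring [Fintype V] [Fintype C] (G : SimpleGraph V) [DecidableRel G.Adj]
    (hG : ∀ v, G.degree v < Fintype.card C) : ∃ c : V → V → Option C, IsEdgeColoring G c := by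
  classical
  let F : Set (SimpleGraph V) := {H | H ≤ G ∧ ∃ c : V → V → Option C, IsEdgeColoring H c}
  have hbot : ⊥ ∈ F := ⟨bot_le, fun _ _ => none, ⟨by simp, by simp, by simp⟩⟩
  obtain ⟨H, ⟨hHG, c, hc⟩, hmax⟩ := F.toFinite.exists_maximal ⟨⊥, hbot⟩
  suffices G ≤ H from le_antisymm this hHG ▸ ⟨c, hc⟩
  intro x y hxy
  by_contra hn
  have hmiss (v : V) : ∃ a, IsMissing c v a :=
    hc.exists_isMissing v ((degree_le_of_le hHG).trans_lt (hG v))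
  have hle : H ⊔ edge x y ≤ H :=
    hmax ⟨sup_le hHG (by rwa [edge_le_iff, or_iff_right hxy.ne]),
      hc.exists_sup_edge hmiss hxy.ne hn⟩ le_sup_left
  exact hn (hle (.inr (by simp [edge_adj, hxy.ne])))

/-- An induced subgraph of a line graph is coloured by one colour more than its clique number. -/
lemma lineGraph_induce_colorable [Fintype V] (G : SimpleGraph V) (s : Set G.edgeSet) :
    (G.lineGraph.induce s).Colorable ((G.lineGraph.induce s).cliqueNum + 1) := by
  classical
  set L := G.lineGraph.induce s
  let G' : SimpleGraph V := fromEdgeSet (Subtype.val '' s)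
  have hadj {u v : V} : G'.Adj u v ↔ ∃ h : G.Adj u v, (⟨s(u, v), h⟩ : G.edgeSet) ∈ s := by
    simp only [G', fromEdgeSet_adj, Set.mem_image, Subtype.exists, exists_and_right,
      exists_eq_right]
    exact ⟨fun h => h.1, fun h => ⟨h, h.1.ne⟩⟩
  have hdeg (v : V) : G'.degree v ≤ L.cliqueNum := by
    have hN (w : G'.neighborFinset v) := hadj.1 ((G'.mem_neighborFinset v w).1 w.2)
    let g : G'.neighborFinset v → s := fun w => ⟨⟨s(v, w), (hN w).1⟩, (hN w).2⟩
    have hg : Function.Injective g := fun a b hab => by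
      have hab' : s(v, (a : V)) = s(v, (b : V)) := congrArg (fun e : s => e.1.1) hab
      exact Subtype.ext (Sym2.congr_right.1 hab')
    have hcl : L.IsClique (Finset.univ.map ⟨g, hg⟩ : Finset s) := by
      intro a ha b hb hab
      simp only [Finset.coe_map, Finset.coe_univ, Set.image_univ, Set.mem_range,
        Function.Embedding.coeFn_mk] at ha hb
      obtain ⟨a, rfl⟩ := ha
      obtain ⟨b, rfl⟩ := hb
      simp only [L, comap_adj, Function.Embedding.subtype_apply]
      exact lineGraph_adj_iff_exists.2 ⟨fun e => hab (Subtype.ext e), v, by simp [g]⟩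
    simpa using hcl.card_le_cliqueNum
  obtain ⟨c, hc⟩ := exists_isEdgeColoring (C := Fin (L.cliqueNum + 1)) G' (fun v => by
    simpa [Nat.lt_succ_iff] using hdeg v)
  refine ⟨Coloring.mk (fun e => (Sym2.lift ⟨c, hc.symm⟩ e.1.1).getD 0) ?_⟩
  rintro ⟨⟨e, he⟩, hes⟩ ⟨⟨e', he'⟩, hes'⟩ hadj' heq
  simp only [L, comap_adj, Function.Embedding.subtype_apply] at hadj'
  obtain ⟨hne, v, hv, hv'⟩ := lineGraph_adj_iff_exists.1 hadj'
  obtain ⟨a, rfl⟩ := Sym2.mem_iff_exists.1 hv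
  obtain ⟨b, rfl⟩ := Sym2.mem_iff_exists.1 hv'
  simp only [Sym2.lift_mk] at heq
  obtain ⟨i, hi⟩ := Option.ne_none_iff_exists'.1
    (fun h => hc.eq_none_iff.1 h (hadj.2 ⟨he, hes⟩))
  obtain ⟨j, hj⟩ := Option.ne_none_iff_exists'.1
    (fun h => hc.eq_none_iff.1 h (hadj.2 ⟨he', hes'⟩))
  simp only [hi, hj, Option.getD_some] at heq
  subst heq
  obtain rfl := hc.proper hi hj
  exact hne rfl

end SimpleGraph

/-- Every line graph is nice. -/
theorem stmt_10 (V : Type) [Fintype V] (G : SimpleGraph V) :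
    IsNice G.lineGraph := by
  classical
  intro s
  have hcol := G.lineGraph_induce_colorable s
  have hle : chi (G.lineGraph.induce s) ≤ (G.lineGraph.induce s).cliqueNum + 1 := Nat.sInf_le hcol
  obtain ⟨t, ht⟩ := (G.lineGraph.induce s).exists_isNClique_cliqueNum
  have hchi : (G.lineGraph.induce s).Colorable (chi (G.lineGraph.induce s)) :=
    Nat.sInf_mem (s := {n | (G.lineGraph.induce s).Colorable n}) ⟨_, hcol⟩
  have hge : (G.lineGraph.induce s).cliqueNum ≤ chi (G.lineGraph.induce s) :=
    ht.card_eq ▸ ht.isClique.card_le_of_colorable hchi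
  omega
end

section
/- For every natural number c there exists a finite simple graph G such that G is nice and the complement of G satisfies χ(Gᶜ) − ω(Gᶜ) > c. That is, the quantity χ − ω can be arbitrarily large for complements of nice graphs. -/
open SimpleGraph

theorem isNice_of_colorable_three {V : Type*} [Finite V] {G : SimpleGraph V}
    (hG : G.Colorable 3) : IsNice G := by
  intro s
  set H := G.induce s
  have h3 : chi H ≤ 3 :=
    chi_le_of_colorable (hG.of_hom (SimpleGraph.Embedding.induce s).toHom)
  have hle := cliqueNum_le_chi H
  rcases isEmpty_or_nonempty s with he | ⟨⟨v⟩⟩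
  · have := chi_le_of_colorable (SimpleGraph.Colorable.of_isEmpty (G := H) 0)
    omega
  have h1 : 1 ≤ H.cliqueNum := by
    simpa using SimpleGraph.IsClique.card_le_cliqueNum (G := H) (t := {v}) (tc := by simp)
  by_cases hbot : H = ⊥
  · have := chi_le_of_colorable (SimpleGraph.colorable_one_iff.2 hbot)
    omega
  obtain ⟨a, b, hab⟩ := SimpleGraph.ne_bot_iff_exists_adj.1 hbot
  have h2 : 2 ≤ H.cliqueNum := by
    classical
    simpa [Finset.card_pair hab.ne] using
      SimpleGraph.IsClique.card_le_cliqueNum (G := H) (t := {a, b})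
        (tc := by simpa [SimpleGraph.isClique_pair] using fun _ => hab)
  omega

/-- The disjoint union of `k` copies of the cycle on five vertices. -/
def disjointPentagons (k : ℕ) : SimpleGraph (Fin k × Fin 5) where
  Adj u v := u.1 = v.1 ∧ (v.2 = u.2 + 1 ∨ u.2 = v.2 + 1)
  symm := ⟨fun _ _ h => ⟨h.1.symm, h.2.symm⟩⟩
  loopless := ⟨fun u h => by
    have : ∀ x : Fin 5, ¬ (x = x + 1 ∨ x = x + 1) := by decide
    exact this _ h.2⟩

theorem disjointPentagons_colorable (k : ℕ) : (disjointPentagons k).Colorable 3 := by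
  have key : ∀ x y : Fin 5, (y = x + 1 ∨ x = y + 1) →
      (![0, 1, 0, 1, 2] : Fin 5 → Fin 3) x ≠ (![0, 1, 0, 1, 2] : Fin 5 → Fin 3) y := by
    decide
  exact ⟨SimpleGraph.Coloring.mk (fun v => (![0, 1, 0, 1, 2] : Fin 5 → Fin 3) v.2)
    fun h => key _ _ h.2⟩

theorem cliqueNum_compl_disjointPentagons_le (k : ℕ) :
    (disjointPentagons k)ᶜ.cliqueNum ≤ 2 * k := by
  obtain ⟨s, hs⟩ := (disjointPentagons k)ᶜ.exists_isNClique_cliqueNum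
  have key : ∀ x y z : Fin 5, x ≠ y → x ≠ z → y ≠ z →
      (y = x + 1 ∨ x = y + 1) ∨ (z = x + 1 ∨ x = z + 1) ∨ (z = y + 1 ∨ y = z + 1) := by
    decide
  have hfib : ∀ i ∈ (Finset.univ : Finset (Fin k)), (s.filter fun v => v.1 = i).card ≤ 2 := by
    intro i _
    by_contra! h
    obtain ⟨⟨a, x⟩, ⟨b, y⟩, ⟨c, z⟩, ha, hb, hc, hab, hac, hbc⟩ := Finset.two_lt_card_iff.1 h
    simp only [Finset.mem_filter] at ha hb hc
    obtain ⟨ha, rfl⟩ := ha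
    obtain ⟨hb, rfl⟩ := hb
    obtain ⟨hc, rfl⟩ := hc
    have nab := (hs.isClique ha hb hab).2
    have nac := (hs.isClique ha hc hac).2
    have nbc := (hs.isClique hb hc hbc).2
    simp only [disjointPentagons, true_and] at nab nac nbc
    rcases key x y z (by simpa using hab) (by simpa using hac) (by simpa using hbc)
      with h | h | h <;> contradiction
  have := Finset.card_le_mul_card_image_of_maps_to (fun v _ => Finset.mem_univ (Prod.fst v)) 2 hfib
  simpa [hs.card_eq] using this

theorem card_le_two_mul_chi_compl_disjointPentagons (k : ℕ) :
    5 * k ≤ 2 * chi (disjointPentagons k)ᶜ := by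
  obtain ⟨C⟩ := colorable_chi (disjointPentagons k)ᶜ
  have key : ∀ x y z : Fin 5, (y = x + 1 ∨ x = y + 1) → (z = x + 1 ∨ x = z + 1) →
      ¬ (z = y + 1 ∨ y = z + 1) := by
    decide
  have adj_of_eq : ∀ u v, u ≠ v → C u = C v → (disjointPentagons k).Adj u v := by
    intro u v huv h
    by_contra hn
    exact C.valid ((SimpleGraph.compl_adj _ _ _).2 ⟨huv, hn⟩) h
  have hfib : ∀ i ∈ (Finset.univ : Finset (Fin (chi (disjointPentagons k)ᶜ))),
      ((Finset.univ : Finset (Fin k × Fin 5)).filter fun v => C v = i).card ≤ 2 := by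
    intro i _
    by_contra! h
    obtain ⟨a, b, c, ha, hb, hc, hab, hac, hbc⟩ := Finset.two_lt_card_iff.1 h
    simp only [Finset.mem_filter, Finset.mem_univ, true_and] at ha hb hc
    exact key _ _ _ (adj_of_eq a b hab (ha.trans hb.symm)).2
      (adj_of_eq a c hac (ha.trans hc.symm)).2 (adj_of_eq b c hbc (hb.trans hc.symm)).2
  have := Finset.card_le_mul_card_image_of_maps_to
    (fun v _ => Finset.mem_univ (C v)) 2 hfib
  simp only [Finset.card_univ, Fintype.card_prod, Fintype.card_fin] at this
  omega

/-- The quantity `χ - ω` can be arbitrarily large for complements of nice graphs. -/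
theorem stmt_13 (c : ℕ) :
    ∃ (V : Type) (_ : Fintype V) (G : SimpleGraph V),
      IsNice G ∧ c < chi Gᶜ - Gᶜ.cliqueNum := by
  refine ⟨_, inferInstance, disjointPentagons (2 * (c + 1)),
    isNice_of_colorable_three (disjointPentagons_colorable _), ?_⟩
  have h1 := cliqueNum_compl_disjointPentagons_le (2 * (c + 1))
  have h2 := card_le_two_mul_chi_compl_disjointPentagons (2 * (c + 1))
  omega
end
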